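/- Let W be a d-dimensional Brownian sheet on [0,1]^2 and let b : [0,1]^2 × ℝ^d → ℝ^d be Borel measurable such that for every i ∈ {1,...,d} one has b_i(s,t,·) = b̂_i(s,t,·) − b̌_i(s,t,·), where b̂_i and b̌_i are bounded and componentwise nondecreasing in x for all (s,t). Then there exists Ω₁ ⊂ Ω with ℙ(Ω₁) = 1 such that for every ω ∈ Ω₁, the identically zero function is the unique continuous function u : [0,1]^2 → ℝ^d satisfying u(s,t) = ∫_0^t ∫_0^s { b(s₁,t₁,W_{s₁,t₁}(ω)+u(s₁,t₁)) − b(s₁,t₁,W_{s₁,t₁}(ω)) } ds₁ dt₁ for all (s,t) ∈ [0,1]^2. -/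

import Mathlib

open MeasureTheory ProbabilityTheory Set Filter

noncomputable section

/-- A `d`-dimensional Brownian sheet on `[0,1]²`. -/
def IsBrownianSheet {Ω : Type*} [MeasurableSpace Ω] (P : Measure Ω) (d : ℕ)
    (W : ℝ × ℝ → Ω → EuclideanSpace ℝ (Fin d)) : Prop :=
  (∀ p, Measurable (W p)) ∧
  (∀ ω, ContinuousOn (fun p => W p ω) (Set.Icc (0 : ℝ × ℝ) 1)) ∧
  (∀ ω, ∀ p ∈ Set.Icc (0 : ℝ × ℝ) 1, p.1 = 0 ∨ p.2 = 0 → W p ω = 0) ∧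
  (∀ (n : ℕ) (p : Fin n → ℝ × ℝ) (idx : Fin n → Fin d) (c : Fin n → ℝ),
    (∀ j, p j ∈ Set.Icc (0 : ℝ × ℝ) 1) →
    P.map (fun ω => ∑ j, c j * W (p j) ω (idx j)) =
      gaussianReal 0 (∑ j, ∑ k, c j * c k *
        (if idx j = idx k then min (p j).1 (p k).1 * min (p j).2 (p k).2 else 0)).toNNReal)

/-- The σ-algebra generated by the sheet up to `p`. -/
def sheetSigma {Ω : Type*} [MeasurableSpace Ω] {d : ℕ}
    (W : ℝ × ℝ → Ω → EuclideanSpace ℝ (Fin d)) (p : ℝ × ℝ) : MeasurableSpace Ω :=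
  ⨆ q ∈ Set.Icc (0 : ℝ × ℝ) p, MeasurableSpace.comap (W q) inferInstance

/-- A strong solution of the sheet SDE. -/
def IsStrongSolution {Ω : Type*} [MeasurableSpace Ω] (P : Measure Ω) {d : ℕ}
    (W : ℝ × ℝ → Ω → EuclideanSpace ℝ (Fin d))
    (b : ℝ × ℝ → EuclideanSpace ℝ (Fin d) → EuclideanSpace ℝ (Fin d))
    (ξ : EuclideanSpace ℝ (Fin d))
    (X : ℝ × ℝ → Ω → EuclideanSpace ℝ (Fin d)) : Prop :=
  (∀ ω, ContinuousOn (fun p => X p ω) (Set.Icc (0 : ℝ × ℝ) 1)) ∧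
  (∀ p ∈ Set.Icc (0 : ℝ × ℝ) 1, ∃ Y : Ω → EuclideanSpace ℝ (Fin d),
      Measurable[sheetSigma W p] Y ∧ ∀ᵐ ω ∂P, X p ω = Y ω) ∧
  (∀ᵐ ω ∂P, ∀ p ∈ Set.Icc (0 : ℝ × ℝ) 1,
      X p ω = ξ + (∫ t₁ in (0:ℝ)..p.2, ∫ s₁ in (0:ℝ)..p.1, b (s₁, t₁) (X (s₁, t₁) ω)) + W p ω)

/-- A continuous image of the Baire space is approximated from inside, in measure, by the images
of compact boxes. -/
theorem exists_isCompact_subset_range_of_lt_measure {α : Type*} [TopologicalSpace α]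
    [PolishSpace α] [MeasurableSpace α] [BorelSpace α] (μ : Measure α) [IsFiniteMeasure μ]
    {f : (ℕ → ℕ) → α} (hf : Continuous f) {r : ENNReal} (hr : r < μ (range f)) :
    ∃ K ⊆ range f, IsCompact K ∧ r ≤ μ K := by
  have step : ∀ (k : ℕ) (C : {C : Set (ℕ → ℕ) // r < μ (f '' C)}),
      ∃ N, r < μ (f '' (C.1 ∩ {x | x k ≤ N})) := by
    intro k C
    have hmono : Monotone fun N => f '' (C.1 ∩ {x | x k ≤ N}) := by
      intro M N hMN
      apply image_mono
      exact inter_subset_inter_right _ fun x (hx : x k ≤ M) => hx.trans hMN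
    have hU : (⋃ N, f '' (C.1 ∩ {x | x k ≤ N})) = f '' C.1 := by
      rw [← image_iUnion, ← inter_iUnion]
      congr 1
      exact inter_eq_left.2 fun x _ => mem_iUnion.2 ⟨x k, le_refl (x k)⟩
    have h := C.2
    rw [← hU, hmono.measure_iUnion] at h
    exact lt_iSup_iff.1 h
  choose N hN using step
  let C : ℕ → {C : Set (ℕ → ℕ) // r < μ (f '' C)} := fun k =>
    Nat.rec ⟨univ, by simpa using hr⟩ (fun k C => ⟨C.1 ∩ {x | x k ≤ N k C}, hN k C⟩) k
  have hC : ∀ k x, (∀ i < k, x i ≤ N i (C i)) ↔ x ∈ (C k).1 := by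
    intro k x
    induction k with
    | zero => simp [C]
    | succ k ih =>
      rw [Nat.forall_lt_succ_right, ih]
      rfl
  let K : Set (ℕ → ℕ) := Set.pi univ fun i => Iic (N i (C i))
  have hK : IsCompact K := isCompact_univ_pi fun i => (finite_Iic _).isCompact
  refine ⟨f '' K, image_subset_range _ _, hK.image hf, ?_⟩
  by_contra! hlt
  obtain ⟨U, hKU, hU, hUr⟩ := (f '' K).exists_isOpen_lt_of_lt r hlt
  have hcyl : ∀ y ∈ K, ∃ n, PiNat.cylinder y n ⊆ f ⁻¹' U := by
    intro y hy
    have hmem : f ⁻¹' U ∈ nhds y := (hU.preimage hf).mem_nhds (hKU (mem_image_of_mem f hy))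
    obtain ⟨t, ⟨x, n, rfl⟩, hyt, ht⟩ :=
      (PiNat.isTopologicalBasis_cylinders (fun _ : ℕ => ℕ)).mem_nhds_iff.1 hmem
    exact ⟨n, by rwa [PiNat.mem_cylinder_iff_eq.1 hyt]⟩
  choose! n hn using hcyl
  obtain ⟨T, hTK, hT⟩ := hK.elim_nhds_subcover (fun y => PiNat.cylinder y (n y))
    (fun y _ => (PiNat.isOpen_cylinder _ y (n y)).mem_nhds (PiNat.self_mem_cylinder y _))
  have hsub : f '' (C (T.sup n)).1 ⊆ U := by
    rintro _ ⟨x, hx, rfl⟩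
    rw [← hC] at hx
    have hz : (fun i => min (x i) (N i (C i))) ∈ K := fun i _ => mem_Iic.2 (min_le_right _ _)
    obtain ⟨y, hyT, hzy⟩ := mem_iUnion₂.1 (hT hz)
    refine hn y (hTK y hyT) fun i hi => ?_
    have h1 := hzy i hi
    exact (min_eq_left (hx i (hi.trans_le (Finset.le_sup hyT)))).symm.trans h1
  exact absurd ((C (T.sup n)).2.trans_le (measure_mono hsub)) hUr.le.not_gt

/-- Analytic sets are universally measurable. -/
theorem nullMeasurableSet_of_analyticSet {α : Type*} [TopologicalSpace α]
    [PolishSpace α] [MeasurableSpace α] [BorelSpace α] (μ : Measure α) [IsFiniteMeasure μ]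
    {s : Set α} (hs : AnalyticSet s) : NullMeasurableSet s μ := by
  rw [AnalyticSet] at hs
  rcases hs with rfl | ⟨f, hf, rfl⟩
  · exact MeasurableSet.empty.nullMeasurableSet
  by_cases h0 : μ (range f) = 0
  · exact NullMeasurableSet.of_null h0
  obtain ⟨r, -, hr, hlim⟩ := exists_seq_strictMono_tendsto' (pos_iff_ne_zero.2 h0)
  choose K hKs hK hrK using fun k =>
    exists_isCompact_subset_range_of_lt_measure μ hf (hr k).2
  have hB : MeasurableSet (⋃ k, K k) := MeasurableSet.iUnion fun k => (hK k).measurableSet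
  have hBs : (⋃ k, K k) ⊆ range f := iUnion_subset hKs
  have hle : μ (range f) ≤ μ (⋃ k, K k) :=
    le_of_tendsto' hlim fun k => (hrK k).trans (measure_mono (subset_iUnion K k))
  have h1 : (⋃ k, K k) =ᵐ[μ] toMeasurable μ (range f) :=
    ae_eq_of_subset_of_measure_ge (hBs.trans (subset_toMeasurable _ _))
      (by rwa [measure_toMeasurable]) hB.nullMeasurableSet (measure_ne_top _ _)
  refine NullMeasurableSet.congr hB.nullMeasurableSet (Filter.EventuallyLE.antisymm ?_ ?_)
  · exact hBs.eventuallyLE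
  · exact (subset_toMeasurable μ (range f)).eventuallyLE.trans h1.symm.le

/-- A function whose strict superlevel sets are analytic is universally measurable. -/
theorem aemeasurable_of_analyticSet_lt {α : Type*} [TopologicalSpace α]
    [PolishSpace α] [MeasurableSpace α] [BorelSpace α] (μ : Measure α) [IsFiniteMeasure μ]
    {F : α → ENNReal} (hF : ∀ c, AnalyticSet {x | c < F x}) : AEMeasurable F μ := by
  have h : NullMeasurable F μ := by
    have : Measurable (β := ENNReal) (fun x : NullMeasurableSpace α μ => F x) :=
      measurable_of_Ioi fun c => nullMeasurableSet_of_analyticSet μ (hF c)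
    exact this
  exact h.aemeasurable

/-- The largest change of `b p` under displacements of `x` of norm at most `m`. -/
def displacementOsc {X E : Type*} [NormedAddCommGroup E] (b : X → E → E) (m : ℝ)
    (q : X × E) : ENNReal :=
  ⨆ v : E, ⨆ _ : ‖v‖ ≤ m, ‖b q.1 (q.2 + v) - b q.1 q.2‖ₑ

theorem aemeasurable_displacementOsc {X E : Type*} [TopologicalSpace X] [PolishSpace X]
    [MeasurableSpace X] [BorelSpace X] [NormedAddCommGroup E] [PolishSpace E]
    [MeasurableSpace E] [BorelSpace E] {b : X → E → E}
    (hb : Measurable fun q : X × E => b q.1 q.2) (m : ℝ) (μ : Measure (X × E))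
    [IsFiniteMeasure μ] : AEMeasurable (displacementOsc b m) μ := by
  have : SecondCountableTopology E := inferInstance
  refine aemeasurable_of_analyticSet_lt μ fun c => ?_
  let S : Set ((X × E) × E) :=
    {z | ‖z.2‖ ≤ m ∧ c < ‖b z.1.1 (z.1.2 + z.2) - b z.1.1 z.1.2‖ₑ}
  have hS : MeasurableSet S := by
    have h0 : MeasurableSet {z : (X × E) × E | ‖z.2‖ ≤ m} :=
      measurableSet_le measurable_snd.norm measurable_const
    have h1 : Measurable fun z : (X × E) × E => b z.1.1 (z.1.2 + z.2) :=
      hb.comp (g := fun q : X × E => b q.1 q.2)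
        (f := fun z : (X × E) × E => (z.1.1, z.1.2 + z.2)) (by fun_prop)
    have h2 : Measurable fun z : (X × E) × E => b z.1.1 z.1.2 := hb.comp measurable_fst
    have h3 : MeasurableSet {z : (X × E) × E |
        c < ‖b z.1.1 (z.1.2 + z.2) - b z.1.1 z.1.2‖ₑ} :=
      measurableSet_lt measurable_const (h1.sub h2).enorm
    exact h0.inter h3
  have himg : {q | c < displacementOsc b m q} = Prod.fst '' S := by
    ext q
    simp only [displacementOsc, mem_ofPred_eq, lt_iSup_iff, mem_image, Prod.exists, S]
    constructor
    · rintro ⟨v, hv, h⟩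
      exact ⟨q.1, q.2, v, ⟨hv, h⟩, rfl⟩
    · rintro ⟨a, x, v, ⟨hv, h⟩, rfl⟩
      exact ⟨v, hv, h⟩
  rw [himg]
  exact hS.analyticSet.image_of_continuous continuous_fst

theorem gaussianPDFReal_zero_le (v : NNReal) (x : ℝ) :
    gaussianPDFReal 0 v x ≤ (√v)⁻¹ := by
  rcases eq_or_ne v 0 with rfl | hv
  · simp
  have hv' : (0 : ℝ) < v := by positivity
  rw [gaussianPDFReal]
  have h1 : Real.exp (-(x - 0) ^ 2 / (2 * v)) ≤ 1 := by
    rw [Real.exp_le_one_iff]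
    exact div_nonpos_of_nonpos_of_nonneg (neg_nonpos.2 (sq_nonneg _)) (by positivity)
  have h2 : (√(2 * Real.pi * v))⁻¹ ≤ (√v)⁻¹ := by
    apply inv_anti₀ (by positivity)
    apply Real.sqrt_le_sqrt
    exact le_mul_of_one_le_left hv'.le (by linarith [Real.pi_gt_three])
  calc _ ≤ (√v)⁻¹ * 1 := mul_le_mul h2 h1 (by positivity) (by positivity)
    _ = _ := mul_one _

theorem gaussianPDFReal_zero_le_of_sq_le (v : NNReal) {x y : ℝ} (h : y ^ 2 ≤ x ^ 2) :
    gaussianPDFReal 0 v x ≤ gaussianPDFReal 0 v y := by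
  rw [gaussianPDFReal, gaussianPDFReal]
  have h' : (y - 0) ^ 2 ≤ (x - 0) ^ 2 := by simpa using h
  gcongr ?_ * Real.exp ?_
  exact div_le_div_of_nonneg_right (neg_le_neg h') (by positivity)

/-- The total variation distance between two shifts of a centred Gaussian is at most
proportional to the shift. -/
theorem integral_abs_gaussianPDFReal_shift_le {v : NNReal} {m : ℝ} (hm : 0 ≤ m) :
    ∫ r, |gaussianPDFReal 0 v (r - m) - gaussianPDFReal 0 v (r + m)| ≤ 4 * m * (√v)⁻¹ := by
  set φ := gaussianPDFReal 0 v with hφ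
  have hint : Integrable φ := integrable_gaussianPDFReal 0 v
  have hi1 : Integrable fun r => φ (r - m) := hint.comp_sub_right m
  have hi2 : Integrable fun r => φ (r + m) := hint.comp_add_right m
  have hmid : ∫ r in Ioc (-m) m, φ r ≤ 2 * m * (√v)⁻¹ := by
    calc ∫ r in Ioc (-m) m, φ r ≤ ∫ r in Ioc (-m) m, (√v)⁻¹ := by
          apply setIntegral_mono hint.integrableOn (integrable_const _)
          exact fun r => gaussianPDFReal_zero_le v r
      _ = 2 * m * (√v)⁻¹ := by
          simp [hm]
          left
          ring
  have hshift : ∀ c, ∫ r in Ioi (0 : ℝ), φ (r + c) = ∫ r in Ioi c, φ r := fun c => by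
    simpa using (measurePreserving_add_right volume c).setIntegral_preimage_emb
      (measurableEmbedding_addRight c) φ (Ioi c)
  have hIoi : ∫ r in Ioi (0 : ℝ), |φ (r - m) - φ (r + m)| ≤ 2 * m * (√v)⁻¹ := by
    have h1 : ∫ r in Ioi (0 : ℝ), |φ (r - m) - φ (r + m)|
        = ∫ r in Ioi (0 : ℝ), (φ (r - m) - φ (r + m)) := by
      apply setIntegral_congr_fun measurableSet_Ioi
      intro r (hr : 0 < r)
      exact abs_of_nonneg (sub_nonneg.2
        (gaussianPDFReal_zero_le_of_sq_le v (by nlinarith)))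
    have h2 : ∫ r in Ioi (0 : ℝ), φ (r - m) = ∫ r in Ioi (-m), φ r := by
      simpa [sub_eq_add_neg] using hshift (-m)
    have h3 : ∫ r in Ioi (0 : ℝ), φ (r + m) = ∫ r in Ioi m, φ r := by
      simpa using hshift m
    rw [h1, integral_sub hi1.integrableOn hi2.integrableOn, h2, h3]
    have h4 : ∫ r in Ioi (-m), φ r = (∫ r in Ioc (-m) m, φ r) + ∫ r in Ioi m, φ r := by
      rw [← setIntegral_union (Ioc_disjoint_Ioi le_rfl) measurableSet_Ioi hint.integrableOn
        hint.integrableOn, Ioc_union_Ioi_eq_Ioi (by linarith)]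
    rwa [h4, add_sub_cancel_right]
  have hIic : ∫ r in Iic (0 : ℝ), |φ (r - m) - φ (r + m)| ≤ 2 * m * (√v)⁻¹ := by
    have hsymm : ∀ x, φ (-x) = φ x := fun x => by simp [hφ, gaussianPDFReal]
    have h1 := integral_comp_neg_Ioi (0 : ℝ) fun r => |φ (r - m) - φ (r + m)|
    rw [neg_zero] at h1
    rw [← h1]
    refine le_trans (le_of_eq ?_) hIoi
    congr 1
    ext r
    rw [← hsymm (r - m), ← hsymm (r + m), abs_sub_comm]
    ring_nf
  have hi : Integrable fun r => |φ (r - m) - φ (r + m)| := (hi1.sub hi2).abs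
  rw [← integral_add_compl measurableSet_Iic hi, compl_Iic]
  exact (add_le_add hIic hIoi).trans_eq (by ring)

/-- The mean increment of a bounded monotone function of a centred Gaussian variable. -/
theorem lintegral_monotone_increment_gaussianReal_le {v : NNReal} (hv : v ≠ 0) {m K : ℝ}
    (hm : 0 ≤ m) {f : ℝ → ℝ} (hf : Monotone f) (hK : ∀ r, |f r| ≤ K) :
    ∫⁻ r, ENNReal.ofReal (f (r + m) - f (r - m)) ∂(gaussianReal 0 v)
      ≤ ENNReal.ofReal (4 * K * m * (√v)⁻¹) := by
  set φ := gaussianPDFReal 0 v with hφ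
  have hint : Integrable φ := integrable_gaussianPDFReal 0 v
  have hbd : ∀ {μ : Measure ℝ} [IsFiniteMeasure μ] (c : ℝ), Integrable (fun r => f (r + c)) μ :=
    fun c => Integrable.of_bound (hf.measurable.comp (measurable_add_const c)).aestronglyMeasurable
      K (ae_of_all _ fun r => hK _)
  have hprod : ∀ c : ℝ, Integrable fun r => f r * φ (r + c) := fun c =>
    (hint.comp_add_right c).bdd_mul hf.measurable.aestronglyMeasurable
      (ae_of_all _ fun r => hK r)
  have hK0 : 0 ≤ K := (abs_nonneg _).trans (hK 0)
  have hshift : ∀ c : ℝ, ∫ r, f (r + c) ∂(gaussianReal 0 v) = ∫ r, f r * φ (r + -c) := by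
    intro c
    rw [integral_gaussianReal_eq_integral_smul hv,
      ← integral_add_right_eq_self (fun r => f r * φ (r + -c)) c]
    congr 1
    ext r
    simp [hφ, mul_comm]
  have hbd' : ∀ {μ : Measure ℝ} [IsFiniteMeasure μ], Integrable (fun r => f (r - m)) μ :=
    hbd (-m)
  have hprod' : Integrable fun r => f r * φ (r - m) := hprod (-m)
  have h2 : ∫ r, f (r - m) ∂(gaussianReal 0 v) = ∫ r, f r * φ (r + m) := by
    simpa [sub_eq_add_neg] using hshift (-m)
  have h3 : ∫ r, f (r + m) ∂(gaussianReal 0 v) = ∫ r, f r * φ (r - m) := hshift m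
  rw [← ofReal_integral_eq_lintegral_ofReal (f := fun r => f (r + m) - f (r - m))
    ((hbd m).sub hbd')
    (ae_of_all _ fun r => sub_nonneg.2 (hf (by linarith)))]
  apply ENNReal.ofReal_le_ofReal
  rw [integral_sub (hbd m) hbd', h2, h3, ← integral_sub hprod' (hprod m)]
  calc ∫ r, (f r * φ (r - m) - f r * φ (r + m))
      ≤ ∫ r, K * |φ (r - m) - φ (r + m)| := by
        refine integral_mono (hprod'.sub (hprod m)) ?_ fun r => ?_
        · exact ((hint.comp_sub_right m).sub (hint.comp_add_right m)).abs.const_mul K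
        · simp only [← mul_sub]
          calc _ ≤ |f r * (φ (r - m) - φ (r + m))| := le_abs_self _
            _ = |f r| * |φ (r - m) - φ (r + m)| := abs_mul _ _
            _ ≤ _ := by gcongr; exact hK r
    _ = K * ∫ r, |φ (r - m) - φ (r + m)| := integral_const_mul _ _
    _ ≤ K * (4 * m * (√v)⁻¹) := by
        gcongr
        exact integral_abs_gaussianPDFReal_shift_le hm
    _ = _ := by ring

namespace IsBrownianSheet

variable {Ω : Type*} [MeasurableSpace Ω] {P : Measure Ω} {d : ℕ}
  {W : ℝ × ℝ → Ω → EuclideanSpace ℝ (Fin d)}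

theorem hasGaussianLaw (hW : IsBrownianSheet P d W) {ι : Type*} [Fintype ι] (p : ι → ℝ × ℝ)
    (hp : ∀ i, p i ∈ Icc (0 : ℝ × ℝ) 1) (idx : ι → Fin d) :
    HasGaussianLaw (fun ω i => W (p i) ω (idx i)) P where
  isGaussian_map := by
    classical
    have hmeas : Measurable fun ω i => W (p i) ω (idx i) :=
      measurable_pi_lambda _ fun i => by have := hW.1 (p i); fun_prop
    refine isGaussian_of_map_eq_gaussianReal fun L => ?_
    have e := Fintype.equivFin ι
    have h := hW.2.2.2 (Fintype.card ι) (fun j => p (e.symm j)) (fun j => idx (e.symm j))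
      (fun j => L (Pi.single (e.symm j) 1)) (fun j => hp _)
    refine ⟨0, _, Eq.trans ?_ h⟩
    rw [Measure.map_map (by fun_prop) hmeas]
    congr 1
    ext ω
    rw [Equiv.sum_comp e.symm fun i => L (Pi.single i 1) * W (p i) ω (idx i), Function.comp_apply]
    conv_lhs => rw [← Finset.univ_sum_single (fun i => W (p i) ω (idx i)), map_sum]
    refine Finset.sum_congr rfl fun i _ => ?_
    rw [mul_comm, ← smul_eq_mul, ← map_smul, ← Pi.single_smul, smul_eq_mul, mul_one]

theorem hasGaussianLaw_apply (hW : IsBrownianSheet P d W) {p : ℝ × ℝ}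
    (hp : p ∈ Icc (0 : ℝ × ℝ) 1) (i : Fin d) : HasGaussianLaw (fun ω => W p ω i) P := by
  simpa using (hW.hasGaussianLaw (fun _ : Unit => p) (fun _ => hp) (fun _ => i)).eval ()

theorem memLp_two (hW : IsBrownianSheet P d W) {p : ℝ × ℝ}
    (hp : p ∈ Icc (0 : ℝ × ℝ) 1) (i : Fin d) : MemLp (fun ω => W p ω i) 2 P :=
  (hW.hasGaussianLaw_apply hp i).memLp_two

theorem integral_apply (hW : IsBrownianSheet P d W) {p : ℝ × ℝ}
    (hp : p ∈ Icc (0 : ℝ × ℝ) 1) (i : Fin d) : ∫ ω, W p ω i ∂P = 0 := by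
  have h := hW.2.2.2 1 (fun _ => p) (fun _ => i) (fun _ => 1) (fun _ => hp)
  have hm : Measurable fun ω => W p ω i := by have := hW.1 p; fun_prop
  simp only [one_mul, Finset.univ_unique, Finset.sum_const, Finset.card_singleton, one_smul] at h
  rw [← integral_map (φ := fun ω => W p ω i) (f := fun x => x) hm.aemeasurable (by fun_prop), h]
  simp

theorem variance_sum (hW : IsBrownianSheet P d W) {n : ℕ} (p : Fin n → ℝ × ℝ)
    (idx : Fin n → Fin d) (c : Fin n → ℝ) (hp : ∀ j, p j ∈ Icc (0 : ℝ × ℝ) 1) :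
    Var[fun ω => ∑ j, c j * W (p j) ω (idx j); P] = (∑ j, ∑ k, c j * c k *
      (if idx j = idx k then min (p j).1 (p k).1 * min (p j).2 (p k).2 else 0)).toNNReal := by
  have hm : Measurable fun ω => ∑ j, c j * W (p j) ω (idx j) :=
    Finset.measurable_sum _ fun j _ => by have := hW.1 (p j); fun_prop
  have h := variance_map (X := id) (Y := fun ω => ∑ j, c j * W (p j) ω (idx j)) (μ := P)
    (by fun_prop) hm.aemeasurable
  rw [hW.2.2.2 n p idx c hp, variance_id_gaussianReal] at h
  exact h.symm

theorem variance_apply (hW : IsBrownianSheet P d W) {p : ℝ × ℝ}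
    (hp : p ∈ Icc (0 : ℝ × ℝ) 1) (i : Fin d) : Var[fun ω => W p ω i; P] = p.1 * p.2 := by
  have h := hW.variance_sum (fun _ : Fin 1 => p) (fun _ => i) (fun _ => 1) (fun _ => hp)
  simp only [one_mul, Finset.univ_unique, Finset.sum_const, Finset.card_singleton, one_smul,
    min_self, if_true] at h
  rw [h, Real.coe_toNNReal _ (mul_nonneg hp.1.1 hp.1.2)]

theorem covariance_apply (hW : IsBrownianSheet P d W) [IsFiniteMeasure P] {p q : ℝ × ℝ}
    (hp : p ∈ Icc (0 : ℝ × ℝ) 1) (hq : q ∈ Icc (0 : ℝ × ℝ) 1) (i j : Fin d) :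
    cov[fun ω => W p ω i, fun ω => W q ω j; P] =
      if i = j then min p.1 q.1 * min p.2 q.2 else 0 := by
  have h := hW.variance_sum ![p, q] ![i, j] ![1, 1] (Fin.forall_fin_two.2 ⟨hp, hq⟩)
  have hmin : 0 ≤ min p.1 q.1 * min p.2 q.2 :=
    mul_nonneg (le_min hp.1.1 hq.1.1) (le_min hp.1.2 hq.1.2)
  have hp' := mul_nonneg hp.1.1 hp.1.2
  have hq' := mul_nonneg hq.1.1 hq.1.2
  simp only [Fin.sum_univ_two, Matrix.cons_val_zero, Matrix.cons_val_one, one_mul, min_self,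
    if_true] at h
  rw [variance_fun_add (hW.memLp_two hp i) (hW.memLp_two hq j), hW.variance_apply hp,
    hW.variance_apply hq, min_comm q.1, min_comm q.2] at h
  by_cases hij : i = j
  · simp only [hij, if_true] at h ⊢
    rw [Real.coe_toNNReal _ (by linarith)] at h
    linarith
  · simp only [hij, Ne.symm hij, if_false] at h ⊢
    rw [Real.coe_toNNReal _ (by linarith)] at h
    linarith

/-- The average over the coordinates of the increment of the sheet between `p` and `q`. -/
def meanIncrement (W : ℝ × ℝ → Ω → EuclideanSpace ℝ (Fin d)) (p q : ℝ × ℝ) (ω : Ω) : ℝ :=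
  (d : ℝ)⁻¹ * ∑ j, (W q ω j - W p ω j)

theorem measurable_meanIncrement (hW : IsBrownianSheet P d W) (p q : ℝ × ℝ) :
    Measurable (meanIncrement W p q) := by
  have := hW.1 p
  have := hW.1 q
  unfold meanIncrement
  fun_prop

theorem memLp_two_meanIncrement (hW : IsBrownianSheet P d W) {p q : ℝ × ℝ}
    (hp : p ∈ Icc (0 : ℝ × ℝ) 1) (hq : q ∈ Icc (0 : ℝ × ℝ) 1) :
    MemLp (meanIncrement W p q) 2 P :=
  (memLp_finsetSum _ fun j _ => (hW.memLp_two hq j).sub (hW.memLp_two hp j)).const_mul _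

/-- The average coordinate increment is jointly Gaussian with the earlier position and with the
remaining part of the later position. -/
theorem hasGaussianLaw_meanIncrement (hW : IsBrownianSheet P d W) {p q : ℝ × ℝ}
    (hp : p ∈ Icc (0 : ℝ × ℝ) 1) (hq : q ∈ Icc (0 : ℝ × ℝ) 1) :
    HasGaussianLaw (fun ω => (fun i : Fin d ⊕ Fin d => Sum.elim (fun i => W p ω i)
      (fun i => W q ω i - meanIncrement W p q ω) i, fun _ : Unit => meanIncrement W p q ω)) P := by
  have hV := hW.hasGaussianLaw (Sum.elim (fun _ : Fin d => p) (fun _ : Fin d => q))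
    (by rintro (i | i) <;> assumption) (Sum.elim id id)
  let R : (Fin d ⊕ Fin d → ℝ) →L[ℝ] ℝ := (d : ℝ)⁻¹ • ∑ j : Fin d,
    ((ContinuousLinearMap.proj (Sum.inr j) : (Fin d ⊕ Fin d → ℝ) →L[ℝ] ℝ) -
      ContinuousLinearMap.proj (Sum.inl j))
  let L : (Fin d ⊕ Fin d → ℝ) →L[ℝ] (Fin d ⊕ Fin d → ℝ) × (Unit → ℝ) :=
    (ContinuousLinearMap.pi fun i : Fin d ⊕ Fin d => (Sum.elim
      (fun i => (ContinuousLinearMap.proj (Sum.inl i) : (Fin d ⊕ Fin d → ℝ) →L[ℝ] ℝ))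
      (fun i => ContinuousLinearMap.proj (Sum.inr i) - R) i)).prod
      (ContinuousLinearMap.pi fun _ : Unit => R)
  have hR : ∀ ω, R (fun i => W (Sum.elim (fun _ : Fin d => p) (fun _ : Fin d => q) i) ω
      (Sum.elim id id i)) = meanIncrement W p q ω := by
    intro ω
    simp [R, meanIncrement]
  have hL : (fun ω => (fun i : Fin d ⊕ Fin d => Sum.elim (fun i => W p ω i)
      (fun i => W q ω i - meanIncrement W p q ω) i, fun _ : Unit => meanIncrement W p q ω)) =
      fun ω => L (fun i => W (Sum.elim (fun _ : Fin d => p) (fun _ : Fin d => q) i) ω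
        (Sum.elim id id i)) := by
    ext ω i
    · rcases i with i | i
      · simp [L]
      · simp [L, hR]
    · simp [L, hR]
  rw [hL]
  exact hV.map_fun L

variable [IsProbabilityMeasure P] {s s' t : ℝ}

theorem covariance_apply_meanIncrement (hW : IsBrownianSheet P d W) {r p q : ℝ × ℝ}
    (hr : r ∈ Icc (0 : ℝ × ℝ) 1) (hp : p ∈ Icc (0 : ℝ × ℝ) 1) (hq : q ∈ Icc (0 : ℝ × ℝ) 1)
    (i : Fin d) : cov[fun ω => W r ω i, meanIncrement W p q; P] =
      (d : ℝ)⁻¹ * (min r.1 q.1 * min r.2 q.2 - min r.1 p.1 * min r.2 p.2) := by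
  unfold meanIncrement
  rw [covariance_const_mul_right, covariance_fun_sum_right
    (X := fun j ω => W q ω j - W p ω j)
    (fun j => (hW.memLp_two hq j).sub (hW.memLp_two hp j)) (hW.memLp_two hr i)]
  congr 1
  have h : ∀ j, cov[fun ω => W r ω i, fun ω => W q ω j - W p ω j; P] =
      if i = j then min r.1 q.1 * min r.2 q.2 - min r.1 p.1 * min r.2 p.2 else 0 := by
    intro j
    rw [covariance_fun_sub_right (hW.memLp_two hr i) (hW.memLp_two hq j) (hW.memLp_two hp j),
      hW.covariance_apply hr hq, hW.covariance_apply hr hp]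
    split_ifs <;> simp
  simp_rw [h]
  simp

theorem variance_meanIncrement (hW : IsBrownianSheet P d W) (hd : 0 < d)
    (hp : (s, t) ∈ Icc (0 : ℝ × ℝ) 1) (hq : (s', t) ∈ Icc (0 : ℝ × ℝ) 1) (hs : s ≤ s') :
    Var[meanIncrement W (s, t) (s', t); P] = (s' - s) * t / d := by
  have hR := hW.memLp_two_meanIncrement hp hq
  have hR2 : meanIncrement W (s, t) (s', t) =
      fun ω => (d : ℝ)⁻¹ * ∑ j, (W (s', t) ω j - W (s, t) ω j) := rfl
  rw [← covariance_self hR.aemeasurable]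
  conv_lhs => enter [1]; rw [hR2]
  rw [covariance_const_mul_left, covariance_fun_sum_left
    (X := fun j ω => W (s', t) ω j - W (s, t) ω j)
    (fun j => (hW.memLp_two hq j).sub (hW.memLp_two hp j)) hR]
  have h : ∀ j, cov[fun ω => W (s', t) ω j - W (s, t) ω j, meanIncrement W (s, t) (s', t); P] =
      (d : ℝ)⁻¹ * ((s' - s) * t) := by
    intro j
    rw [covariance_fun_sub_left (hW.memLp_two hq j) (hW.memLp_two hp j) hR,
      hW.covariance_apply_meanIncrement hq hp hq, hW.covariance_apply_meanIncrement hp hp hq]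
    simp only [min_self, min_eq_left hs, min_eq_right hs]
    ring
  simp_rw [h]
  have : (d : ℝ) ≠ 0 := by positivity
  simp
  field_simp

theorem map_meanIncrement (hW : IsBrownianSheet P d W) (hd : 0 < d)
    (hp : (s, t) ∈ Icc (0 : ℝ × ℝ) 1) (hq : (s', t) ∈ Icc (0 : ℝ × ℝ) 1) (hs : s ≤ s') :
    P.map (meanIncrement W (s, t) (s', t)) = gaussianReal 0 ((s' - s) * t / d).toNNReal := by
  have hG : HasGaussianLaw (meanIncrement W (s, t) (s', t)) P :=
    (hW.hasGaussianLaw_meanIncrement hp hq).snd.eval ()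
  have hi : ∀ {p}, p ∈ Icc (0 : ℝ × ℝ) 1 → ∀ j, Integrable (fun ω => W p ω j) P :=
    fun hp j => (hW.hasGaussianLaw_apply hp j).integrable
  rw [hG.map_eq_gaussianReal, hW.variance_meanIncrement hd hp hq hs]
  congr 1
  unfold meanIncrement
  rw [integral_const_mul, integral_finsetSum
    (f := fun j ω => W (s', t) ω j - W (s, t) ω j) _ fun j _ => (hi hq j).sub (hi hp j)]
  simp [integral_sub (hi hq _) (hi hp _), hW.integral_apply hp, hW.integral_apply hq]

/-- The average coordinate increment is independent of the earlier position and of the remaining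
part of the later position. -/
theorem indepFun_meanIncrement (hW : IsBrownianSheet P d W) (hd : 0 < d)
    (hp : (s, t) ∈ Icc (0 : ℝ × ℝ) 1) (hq : (s', t) ∈ Icc (0 : ℝ × ℝ) 1) (hs : s ≤ s') :
    IndepFun (fun ω => (W (s, t) ω,
      W (s', t) ω - meanIncrement W (s, t) (s', t) ω • WithLp.toLp 2 (fun _ => (1 : ℝ))))
      (meanIncrement W (s, t) (s', t)) P := by
  have hR := hW.memLp_two_meanIncrement hp hq
  have h := (hW.hasGaussianLaw_meanIncrement hp hq).indepFun_of_covariance_eval (by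
    rintro (i | i) _
    · simp only [Sum.elim_inl]
      rw [hW.covariance_apply_meanIncrement hp hp hq]
      simp [min_eq_left hs]
    · simp only [Sum.elim_inr]
      rw [covariance_fun_sub_left (hW.memLp_two hq i) hR hR,
        hW.covariance_apply_meanIncrement hq hp hq, covariance_self hR.aemeasurable,
        hW.variance_meanIncrement hd hp hq hs]
      simp only [min_self, min_eq_right hs]
      ring)
  convert h.comp (φ := fun z : Fin d ⊕ Fin d → ℝ => (WithLp.toLp 2 (fun i => z (Sum.inl i)),
    WithLp.toLp 2 (fun i => z (Sum.inr i)))) (ψ := fun z : Unit → ℝ => z ()) (by fun_prop)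
    (by exact measurable_pi_apply (X := fun _ : Unit => ℝ) ()) using 1
  · ext ω i <;> simp
  · rfl

end IsBrownianSheet

theorem aemeasurable_displacementOsc_comp {α X E : Type*} [MeasurableSpace α]
    [TopologicalSpace X] [PolishSpace X]
    [MeasurableSpace X] [BorelSpace X] [NormedAddCommGroup E] [PolishSpace E]
    [MeasurableSpace E] [BorelSpace E] {b : X → E → E}
    (hb : Measurable fun q : X × E => b q.1 q.2) (m : ℝ) {μ : Measure α} [IsFiniteMeasure μ]
    {f : α → X × E} (hf : Measurable f) :
    AEMeasurable (fun a => displacementOsc b m (f a)) μ :=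
  (aemeasurable_displacementOsc hb m (μ.map f)).comp_measurable hf

theorem EuclideanSpace.norm_le_sum_abs {d : ℕ} (x : EuclideanSpace ℝ (Fin d)) :
    ‖x‖ ≤ ∑ i, |x i| := by
  conv_lhs => rw [← (EuclideanSpace.basisFun (Fin d) ℝ).sum_repr x]
  refine (norm_sum_le _ _).trans (Finset.sum_le_sum fun i _ => ?_)
  simp [norm_smul]

theorem displacementOsc_le_ofReal {X : Type*} {d : ℕ}
    {b bhat bcheck : X → EuclideanSpace ℝ (Fin d) → EuclideanSpace ℝ (Fin d)}
    (hdecomp : ∀ p x, b p x = bhat p x - bcheck p x)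
    (hmono : ∀ p (x y : EuclideanSpace ℝ (Fin d)), (∀ j, x j ≤ y j) →
      ∀ i, bhat p x i ≤ bhat p y i ∧ bcheck p x i ≤ bcheck p y i)
    (m : ℝ) (p : X) (x : EuclideanSpace ℝ (Fin d)) :
    displacementOsc b m (p, x) ≤ ENNReal.ofReal
      (∑ i, (bhat p (x + m • WithLp.toLp 2 (fun _ => (1 : ℝ))) i +
          bcheck p (x + m • WithLp.toLp 2 (fun _ => (1 : ℝ))) i) -
        ∑ i, (bhat p (x - m • WithLp.toLp 2 (fun _ => (1 : ℝ))) i +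
          bcheck p (x - m • WithLp.toLp 2 (fun _ => (1 : ℝ))) i)) := by
  set e : EuclideanSpace ℝ (Fin d) := WithLp.toLp 2 (fun _ => (1 : ℝ)) with he
  refine iSup₂_le fun v hv => ?_
  rw [← ofReal_norm]
  refine ENNReal.ofReal_le_ofReal ?_
  have hm : 0 ≤ m := (norm_nonneg v).trans hv
  have hvi : ∀ j, |v j| ≤ m := fun j => by
    have := PiLp.norm_apply_le v j
    rw [Real.norm_eq_abs] at this
    exact this.trans hv
  have h1 : ∀ j, (x - m • e) j ≤ (x + v) j := fun j => by
    have := abs_le.1 (hvi j)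
    simp [he]; linarith
  have h2 : ∀ j, (x + v) j ≤ (x + m • e) j := fun j => by
    have := abs_le.1 (hvi j)
    simp [he]; linarith
  have h3 : ∀ j, (x - m • e) j ≤ x j := fun j => by
    simp [he]; linarith
  have h4 : ∀ j, x j ≤ (x + m • e) j := fun j => by
    simp [he]; linarith
  rw [← Finset.sum_sub_distrib]
  refine (EuclideanSpace.norm_le_sum_abs _).trans (Finset.sum_le_sum fun i _ => ?_)
  rw [hdecomp, hdecomp]
  obtain ⟨a1, a2⟩ := hmono p _ _ h1 i
  obtain ⟨a3, a4⟩ := hmono p _ _ h2 i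
  obtain ⟨a5, a6⟩ := hmono p _ _ h3 i
  obtain ⟨a7, a8⟩ := hmono p _ _ h4 i
  simp only [PiLp.sub_apply]
  rw [abs_le]
  constructor <;> linarith

/-- The reciprocal of the square root, with value zero on the nonpositive reals. -/
def invSqrt (x : ℝ) : ENNReal := ENNReal.ofReal (√x)⁻¹

theorem measurable_invSqrt : Measurable invSqrt := by
  unfold invSqrt
  fun_prop

theorem ofReal_inv_sqrt_gaussian {d : ℕ} {a s t : ℝ} (ha : 0 ≤ a) (hs : 0 ≤ s) :
    ENNReal.ofReal (a * (√((s * t / d).toNNReal : ℝ))⁻¹) ≤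
      ENNReal.ofReal (a * √d) * invSqrt s * invSqrt t := by
  unfold invSqrt
  rw [← ENNReal.ofReal_mul (by positivity), ← ENNReal.ofReal_mul (by positivity)]
  refine ENNReal.ofReal_le_ofReal (le_of_eq ?_)
  rcases le_or_gt 0 t with ht | ht
  · rw [Real.coe_toNNReal _ (by positivity), Real.sqrt_div (by positivity), Real.sqrt_mul hs,
      inv_div, div_eq_mul_inv, mul_inv]
    ring
  · rw [Real.toNNReal_of_nonpos (div_nonpos_of_nonpos_of_nonneg
      (mul_nonpos_of_nonneg_of_nonpos hs ht.le) (by positivity)), Real.sqrt_eq_zero_of_nonpos ht.le]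
    simp

namespace IsBrownianSheet

variable {Ω : Type*} [MeasurableSpace Ω] {P : Measure Ω} [IsProbabilityMeasure P] {d : ℕ}
  {W : ℝ × ℝ → Ω → EuclideanSpace ℝ (Fin d)}
  {b bhat bcheck : ℝ × ℝ → EuclideanSpace ℝ (Fin d) → EuclideanSpace ℝ (Fin d)}

/-- The conditional expectation estimate at the origin of the uniqueness proof: conditionally on
an earlier position on the same horizontal line, the expected oscillation of `b` under
displacements of size at most `m` is linear in `m`. -/
theorem lintegral_mul_displacementOsc_le (hW : IsBrownianSheet P d W) (hd : 0 < d)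
    (hmeas : Measurable fun q : (ℝ × ℝ) × EuclideanSpace ℝ (Fin d) => b q.1 q.2)
    {K : ℝ} (hK : ∀ p x, |∑ i, (bhat p x i + bcheck p x i)| ≤ K)
    (hdecomp : ∀ p x, b p x = bhat p x - bcheck p x)
    (hmono : ∀ p (x y : EuclideanSpace ℝ (Fin d)), (∀ j, x j ≤ y j) →
      ∀ i, bhat p x i ≤ bhat p y i ∧ bcheck p x i ≤ bcheck p y i)
    {m : ℝ} (hm : 0 ≤ m) {F : EuclideanSpace ℝ (Fin d) → ENNReal}
    (hF : ∀ (μ : Measure (EuclideanSpace ℝ (Fin d))) [IsFiniteMeasure μ], AEMeasurable F μ)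
    {s s' t : ℝ} (hp : (s, t) ∈ Icc (0 : ℝ × ℝ) 1) (hq : (s', t) ∈ Icc (0 : ℝ × ℝ) 1)
    (hs : s < s') (ht : 0 < t) :
    ∫⁻ ω, F (W (s, t) ω) * displacementOsc b m ((s', t), W (s', t) ω) ∂P ≤
      (∫⁻ ω, F (W (s, t) ω) ∂P) *
        (ENNReal.ofReal (4 * K * m * √d) * invSqrt (s' - s) * invSqrt t) := by
  set e : EuclideanSpace ℝ (Fin d) := WithLp.toLp 2 (fun _ => (1 : ℝ)) with he
  have hK0 : 0 ≤ K := (abs_nonneg _).trans (hK 0 0)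
  set R := meanIncrement W (s, t) (s', t)
  have hR : Measurable R := hW.measurable_meanIncrement _ _
  have hWp := hW.1 (s, t)
  have hWq := hW.1 (s', t)
  set Z : Ω → EuclideanSpace ℝ (Fin d) × EuclideanSpace ℝ (Fin d) :=
    fun ω => (W (s, t) ω, W (s', t) ω - R ω • e) with hZ
  have hZm : Measurable Z := by fun_prop
  have hind : IndepFun Z R P := hW.indepFun_meanIncrement hd hp hq hs.le
  have hmap := (indepFun_iff_map_prod_eq_prod_map_map hZm.aemeasurable hR.aemeasurable).1 hind
  set v : NNReal := ((s' - s) * t / d).toNNReal with hv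
  have hv0 : v ≠ 0 := by
    have hss : 0 < s' - s := sub_pos.2 hs
    exact (Real.toNNReal_pos.2 (by positivity)).ne'
  rw [hW.map_meanIncrement hd hp hq hs.le] at hmap
  have : IsProbabilityMeasure (P.map Z) := Measure.isProbabilityMeasure_map hZm.aemeasurable
  set G : (EuclideanSpace ℝ (Fin d) × EuclideanSpace ℝ (Fin d)) × ℝ → ENNReal :=
    fun z => F z.1.1 * displacementOsc b m ((s', t), z.1.2 + z.2 • e) with hG
  have hGm : AEMeasurable G ((P.map Z).prod (gaussianReal 0 v)) := by
    refine AEMeasurable.mul ?_ ?_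
    · exact (hF _).comp_measurable (f := fun z : (EuclideanSpace ℝ (Fin d) ×
        EuclideanSpace ℝ (Fin d)) × ℝ => z.1.1) (by fun_prop)
    · exact aemeasurable_displacementOsc_comp hmeas m
        (f := fun z : (EuclideanSpace ℝ (Fin d) × EuclideanSpace ℝ (Fin d)) × ℝ =>
          ((s', t), z.1.2 + z.2 • e)) (by fun_prop)
  have hinner : ∀ y, ∫⁻ r, displacementOsc b m ((s', t), y + r • e) ∂(gaussianReal 0 v) ≤
      ENNReal.ofReal (4 * K * m * (√v)⁻¹) := by
    intro y
    refine le_trans (lintegral_mono fun r => displacementOsc_le_ofReal hdecomp hmono m _ _) ?_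
    refine le_trans (le_of_eq ?_) (lintegral_monotone_increment_gaussianReal_le hv0 hm
      (f := fun r => ∑ i, (bhat (s', t) (y + r • e) i + bcheck (s', t) (y + r • e) i)) ?_
      fun r => hK _ _)
    · refine lintegral_congr fun r => ?_
      rw [add_smul, sub_smul, add_assoc, add_sub_assoc]
    · intro r r' hr
      have hle : ∀ j, (y + r • e) j ≤ (y + r' • e) j := fun j => by simp [he, hr]
      exact Finset.sum_le_sum fun i _ => add_le_add (hmono _ _ _ hle i).1 (hmono _ _ _ hle i).2
  calc ∫⁻ ω, F (W (s, t) ω) * displacementOsc b m ((s', t), W (s', t) ω) ∂P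
      = ∫⁻ ω, G (Z ω, R ω) ∂P := by simp [hG, hZ]
    _ = ∫⁻ z, G z ∂((P.map Z).prod (gaussianReal 0 v)) := by
        rw [← hmap, lintegral_map' (by rw [hmap]; exact hGm) (by fun_prop)]
    _ = ∫⁻ z, F z.1 * ∫⁻ r, displacementOsc b m ((s', t), z.2 + r • e) ∂(gaussianReal 0 v)
          ∂(P.map Z) := by
        rw [lintegral_prod _ hGm]
        refine lintegral_congr fun z => ?_
        exact lintegral_const_mul'' (F z.1) (aemeasurable_displacementOsc_comp hmeas m
          (μ := gaussianReal 0 v) (f := fun r : ℝ => ((s', t), z.2 + r • e)) (by fun_prop))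
    _ ≤ ∫⁻ z, F z.1 * ENNReal.ofReal (4 * K * m * (√v)⁻¹) ∂(P.map Z) :=
        lintegral_mono fun z => mul_le_mul_right (hinner z.2) _
    _ = (∫⁻ ω, F (W (s, t) ω) ∂P) * ENNReal.ofReal (4 * K * m * (√v)⁻¹) := by
        have hFm : AEMeasurable (fun z : EuclideanSpace ℝ (Fin d) × EuclideanSpace ℝ (Fin d) =>
          F z.1) (P.map Z) := (hF _).comp_measurable measurable_fst
        rw [lintegral_mul_const'' _ hFm, lintegral_map' hFm hZm.aemeasurable]
    _ ≤ _ := by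
        gcongr
        exact ofReal_inv_sqrt_gaussian (by positivity) (sub_nonneg.2 hs.le)

theorem lintegral_displacementOsc_le (hW : IsBrownianSheet P d W) (hd : 0 < d)
    (hmeas : Measurable fun q : (ℝ × ℝ) × EuclideanSpace ℝ (Fin d) => b q.1 q.2)
    {K : ℝ} (hK : ∀ p x, |∑ i, (bhat p x i + bcheck p x i)| ≤ K)
    (hdecomp : ∀ p x, b p x = bhat p x - bcheck p x)
    (hmono : ∀ p (x y : EuclideanSpace ℝ (Fin d)), (∀ j, x j ≤ y j) →
      ∀ i, bhat p x i ≤ bhat p y i ∧ bcheck p x i ≤ bcheck p y i)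
    {m : ℝ} (hm : 0 ≤ m) {s t : ℝ} (hp : (s, t) ∈ Icc (0 : ℝ × ℝ) 1) (hs : 0 < s) (ht : 0 < t) :
    ∫⁻ ω, displacementOsc b m ((s, t), W (s, t) ω) ∂P ≤
      ENNReal.ofReal (4 * K * m * √d) * invSqrt s * invSqrt t := by
  have h := hW.lintegral_mul_displacementOsc_le hd hmeas hK hdecomp hmono hm (F := fun _ => 1)
    (fun μ _ => aemeasurable_const) (s := 0)
    (show ((0 : ℝ), t) ∈ Icc (0 : ℝ × ℝ) 1 from ⟨⟨le_rfl, ht.le⟩, ⟨zero_le_one, hp.2.2⟩⟩) hp hs ht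
  simpa using h

theorem lintegral_displacementOsc_mul_displacementOsc_le (hW : IsBrownianSheet P d W) (hd : 0 < d)
    (hmeas : Measurable fun q : (ℝ × ℝ) × EuclideanSpace ℝ (Fin d) => b q.1 q.2)
    {K : ℝ} (hK : ∀ p x, |∑ i, (bhat p x i + bcheck p x i)| ≤ K)
    (hdecomp : ∀ p x, b p x = bhat p x - bcheck p x)
    (hmono : ∀ p (x y : EuclideanSpace ℝ (Fin d)), (∀ j, x j ≤ y j) →
      ∀ i, bhat p x i ≤ bhat p y i ∧ bcheck p x i ≤ bcheck p y i)
    {m : ℝ} (hm : 0 ≤ m) {s s' t : ℝ} (hp : (s, t) ∈ Icc (0 : ℝ × ℝ) 1)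
    (hq : (s', t) ∈ Icc (0 : ℝ × ℝ) 1) (hs : 0 < s) (hs' : 0 < s') (hss : s ≠ s') (ht : 0 < t) :
    ∫⁻ ω, displacementOsc b m ((s, t), W (s, t) ω) *
        displacementOsc b m ((s', t), W (s', t) ω) ∂P ≤
      ENNReal.ofReal (4 * K * m * √d) ^ 2 * invSqrt t ^ 2 *
        (invSqrt s * invSqrt (s' - s) + invSqrt s' * invSqrt (s - s')) := by
  have key : ∀ {s s' : ℝ}, (s, t) ∈ Icc (0 : ℝ × ℝ) 1 → (s', t) ∈ Icc (0 : ℝ × ℝ) 1 → 0 < s →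
      s < s' → ∫⁻ ω, displacementOsc b m ((s, t), W (s, t) ω) *
        displacementOsc b m ((s', t), W (s', t) ω) ∂P ≤
      ENNReal.ofReal (4 * K * m * √d) ^ 2 * invSqrt t ^ 2 *
        (invSqrt s * invSqrt (s' - s)) := by
    intro s s' hp hq hs hss
    refine (hW.lintegral_mul_displacementOsc_le hd hmeas hK hdecomp hmono hm
      (F := fun x => displacementOsc b m ((s, t), x))
      (fun μ _ => aemeasurable_displacementOsc_comp hmeas m (by fun_prop)) hp hq hss ht).trans ?_
    refine (mul_le_mul_left (hW.lintegral_displacementOsc_le hd hmeas hK hdecomp hmono hm hp hs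
      ht) _).trans (le_of_eq (by ring))
  rcases hss.lt_or_gt with h | h
  · exact (key hp hq hs h).trans (by gcongr; exact le_self_add)
  · refine le_trans (le_of_eq ?_) ((key hq hp hs' h).trans (by gcongr; exact le_add_self))
    simp_rw [mul_comm]

end IsBrownianSheet

theorem lintegral_invSqrt_Ioo : ∫⁻ x in Ioo (0 : ℝ) 1, invSqrt x = 2 := by
  have hrpow : ∀ x ∈ Ioo (0 : ℝ) 1, x ^ (-(1 / 2) : ℝ) = (√x)⁻¹ := fun x hx => by
    rw [Real.rpow_neg hx.1.le, Real.sqrt_eq_rpow]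
  have hint : IntegrableOn (fun x : ℝ => x ^ (-(1 / 2) : ℝ)) (Ioo 0 1) :=
    (intervalIntegral.integrableOn_Ioo_rpow_iff one_pos).2 (by norm_num)
  have hval : ∫ x in Ioo (0 : ℝ) 1, x ^ (-(1 / 2) : ℝ) = 2 := by
    rw [← integral_Ioc_eq_integral_Ioo, ← intervalIntegral.integral_of_le zero_le_one,
      integral_rpow (Or.inl (by norm_num))]
    norm_num
  unfold invSqrt
  rw [← setLIntegral_congr_fun measurableSet_Ioo (fun x hx => by rw [← hrpow x hx]),
    ← ofReal_integral_eq_lintegral_ofReal hint, hval]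
  · norm_num
  · filter_upwards [self_mem_ae_restrict measurableSet_Ioo] with x hx
    exact Real.rpow_nonneg (le_of_lt hx.1) _

theorem lintegral_invSqrt_sub_le {s : ℝ} (hs : 0 ≤ s) :
    ∫⁻ x in Ioo (0 : ℝ) 1, invSqrt (x - s) ≤ 2 := by
  rw [← lintegral_invSqrt_Ioo, ← lintegral_indicator measurableSet_Ioo,
    ← lintegral_indicator measurableSet_Ioo,
    ← lintegral_sub_right_eq_self (fun x => (Ioo (0 : ℝ) 1).indicator invSqrt x) s]
  refine lintegral_mono fun x => ?_
  by_cases hx : x ∈ Ioo (0 : ℝ) 1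
  · rw [indicator_of_mem hx]
    rcases le_or_gt (x - s) 0 with h | h
    · simp [invSqrt, Real.sqrt_eq_zero_of_nonpos h]
    · rw [indicator_of_mem (show x - s ∈ Ioo (0 : ℝ) 1 from ⟨h, by linarith [hx.2]⟩)]
  · rw [indicator_of_notMem hx]
    exact zero_le

theorem lintegral_lintegral_invSqrt_le :
    ∫⁻ s in Ioo (0 : ℝ) 1, ∫⁻ s' in Ioo (0 : ℝ) 1,
      (invSqrt s * invSqrt (s' - s) + invSqrt s' * invSqrt (s - s')) ≤ 8 := by
  have hm := measurable_invSqrt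
  have key : ∫⁻ s in Ioo (0 : ℝ) 1, ∫⁻ s' in Ioo (0 : ℝ) 1, invSqrt s * invSqrt (s' - s) ≤ 4 := by
    calc ∫⁻ s in Ioo (0 : ℝ) 1, ∫⁻ s' in Ioo (0 : ℝ) 1, invSqrt s * invSqrt (s' - s)
        ≤ ∫⁻ s in Ioo (0 : ℝ) 1, invSqrt s * 2 := by
          refine setLIntegral_mono (by fun_prop) fun s hs => ?_
          rw [lintegral_const_mul _ (by fun_prop)]
          gcongr
          exact lintegral_invSqrt_sub_le hs.1.le
      _ = 4 := by
          rw [lintegral_mul_const _ hm, lintegral_invSqrt_Ioo]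
          norm_num
  have hswap : ∫⁻ s in Ioo (0 : ℝ) 1, ∫⁻ s' in Ioo (0 : ℝ) 1, invSqrt s' * invSqrt (s - s') =
      ∫⁻ s in Ioo (0 : ℝ) 1, ∫⁻ s' in Ioo (0 : ℝ) 1, invSqrt s * invSqrt (s' - s) :=
    lintegral_lintegral_swap (f := fun s s' => invSqrt s' * invSqrt (s - s'))
      (by unfold Function.uncurry; fun_prop)
  calc _ = (∫⁻ s in Ioo (0 : ℝ) 1, ∫⁻ s' in Ioo (0 : ℝ) 1, invSqrt s * invSqrt (s' - s)) +
        ∫⁻ s in Ioo (0 : ℝ) 1, ∫⁻ s' in Ioo (0 : ℝ) 1, invSqrt s' * invSqrt (s - s') := by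
        rw [← lintegral_add_left]
        · refine lintegral_congr fun s => ?_
          rw [lintegral_add_left (by fun_prop)]
        · exact Measurable.lintegral_prod_right' (f := fun z : ℝ × ℝ =>
            invSqrt z.1 * invSqrt (z.2 - z.1)) (by fun_prop)
    _ ≤ 4 + 4 := by rw [hswap]; exact add_le_add key key
    _ = 8 := by norm_num

/-- The weighted energy, along the path `w`, of the oscillation of `b` under displacements of size
at most `m`. -/
def oscEnergy {d : ℕ} (b : ℝ × ℝ → EuclideanSpace ℝ (Fin d) → EuclideanSpace ℝ (Fin d))
    (w : ℝ × ℝ → EuclideanSpace ℝ (Fin d)) (m : ℝ) : ENNReal :=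
  ∫⁻ t in Ioo (0 : ℝ) 1, ENNReal.ofReal √t *
    (∫⁻ s in Ioo (0 : ℝ) 1, displacementOsc b m ((s, t), w (s, t))) ^ 2

namespace IsBrownianSheet

variable {Ω : Type*} [MeasurableSpace Ω] {P : Measure Ω} [IsProbabilityMeasure P] {d : ℕ}
  {W : ℝ × ℝ → Ω → EuclideanSpace ℝ (Fin d)}
  {b bhat bcheck : ℝ × ℝ → EuclideanSpace ℝ (Fin d) → EuclideanSpace ℝ (Fin d)}

theorem lintegral_sq_lintegral_displacementOsc_le (hW : IsBrownianSheet P d W)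
    (hWm : Measurable fun z : (ℝ × ℝ) × Ω => W z.1 z.2) (hd : 0 < d)
    (hmeas : Measurable fun q : (ℝ × ℝ) × EuclideanSpace ℝ (Fin d) => b q.1 q.2)
    {K : ℝ} (hK : ∀ p x, |∑ i, (bhat p x i + bcheck p x i)| ≤ K)
    (hdecomp : ∀ p x, b p x = bhat p x - bcheck p x)
    (hmono : ∀ p (x y : EuclideanSpace ℝ (Fin d)), (∀ j, x j ≤ y j) →
      ∀ i, bhat p x i ≤ bhat p y i ∧ bcheck p x i ≤ bcheck p y i)
    {m : ℝ} (hm : 0 ≤ m) {t : ℝ} (ht : t ∈ Ioo (0 : ℝ) 1) :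
    ∫⁻ ω, (∫⁻ s in Ioo (0 : ℝ) 1, displacementOsc b m ((s, t), W (s, t) ω)) ^ 2 ∂P ≤
      ENNReal.ofReal (4 * K * m * √d) ^ 2 * invSqrt t ^ 2 * 8 := by
  set μ : Measure ℝ := volume.restrict (Ioo (0 : ℝ) 1) with hμ
  have hms : ∀ ω, AEMeasurable (fun s => displacementOsc b m ((s, t), W (s, t) ω)) μ := fun ω =>
    aemeasurable_displacementOsc_comp hmeas m (f := fun s => ((s, t), W (s, t) ω)) (by fun_prop)
  have hm3 : AEMeasurable (fun z : (Ω × ℝ) × ℝ => displacementOsc b m ((z.1.2, t),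
      W (z.1.2, t) z.1.1) * displacementOsc b m ((z.2, t), W (z.2, t) z.1.1))
      ((P.prod μ).prod μ) :=
    (aemeasurable_displacementOsc_comp hmeas m (f := fun z : (Ω × ℝ) × ℝ =>
      ((z.1.2, t), W (z.1.2, t) z.1.1)) (by fun_prop)).mul
      (aemeasurable_displacementOsc_comp hmeas m (f := fun z : (Ω × ℝ) × ℝ =>
      ((z.2, t), W (z.2, t) z.1.1)) (by fun_prop))
  have hm2 : ∀ s, AEMeasurable (fun z : Ω × ℝ => displacementOsc b m ((s, t),
      W (s, t) z.1) * displacementOsc b m ((z.2, t), W (z.2, t) z.1)) (P.prod μ) := fun s =>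
    (aemeasurable_displacementOsc_comp hmeas m (f := fun z : Ω × ℝ =>
      ((s, t), W (s, t) z.1)) (by fun_prop)).mul
      (aemeasurable_displacementOsc_comp hmeas m (f := fun z : Ω × ℝ =>
      ((z.2, t), W (z.2, t) z.1)) (by fun_prop))
  calc ∫⁻ ω, (∫⁻ s, displacementOsc b m ((s, t), W (s, t) ω) ∂μ) ^ 2 ∂P
      = ∫⁻ ω, ∫⁻ s, ∫⁻ s', displacementOsc b m ((s, t), W (s, t) ω) *
          displacementOsc b m ((s', t), W (s', t) ω) ∂μ ∂μ ∂P := by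
        refine lintegral_congr fun ω => ?_
        rw [sq, ← lintegral_mul_const'' _ (hms ω)]
        exact lintegral_congr fun s => (lintegral_const_mul'' _ (hms ω)).symm
    _ = ∫⁻ s, ∫⁻ ω, ∫⁻ s', displacementOsc b m ((s, t), W (s, t) ω) *
          displacementOsc b m ((s', t), W (s', t) ω) ∂μ ∂P ∂μ :=
        lintegral_lintegral_swap hm3.lintegral_prod_right'
    _ = ∫⁻ s, ∫⁻ s', ∫⁻ ω, displacementOsc b m ((s, t), W (s, t) ω) *
          displacementOsc b m ((s', t), W (s', t) ω) ∂P ∂μ ∂μ :=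
        lintegral_congr fun s => lintegral_lintegral_swap (hm2 s)
    _ ≤ ∫⁻ s, ∫⁻ s', ENNReal.ofReal (4 * K * m * √d) ^ 2 * invSqrt t ^ 2 *
          (invSqrt s * invSqrt (s' - s) + invSqrt s' * invSqrt (s - s')) ∂μ ∂μ := by
        refine lintegral_mono_ae ?_
        filter_upwards [self_mem_ae_restrict measurableSet_Ioo] with s hs
        refine lintegral_mono_ae ?_
        filter_upwards [self_mem_ae_restrict measurableSet_Ioo, Measure.ae_ne μ s] with s' hs' hne
        exact hW.lintegral_displacementOsc_mul_displacementOsc_le hd hmeas hK hdecomp hmono hm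
          ⟨⟨le_of_lt hs.1, ht.1.le⟩, ⟨le_of_lt hs.2, ht.2.le⟩⟩
          ⟨⟨le_of_lt hs'.1, ht.1.le⟩, ⟨le_of_lt hs'.2, ht.2.le⟩⟩ hs.1 hs'.1 hne.symm ht.1
    _ = ENNReal.ofReal (4 * K * m * √d) ^ 2 * invSqrt t ^ 2 * ∫⁻ s, ∫⁻ s',
          (invSqrt s * invSqrt (s' - s) + invSqrt s' * invSqrt (s - s')) ∂μ ∂μ := by
        have hi := measurable_invSqrt
        rw [← lintegral_const_mul]
        · refine lintegral_congr fun s => ?_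
          rw [lintegral_const_mul _ (by fun_prop)]
        · exact Measurable.lintegral_prod_right' (f := fun z : ℝ × ℝ =>
            invSqrt z.1 * invSqrt (z.2 - z.1) + invSqrt z.2 * invSqrt (z.1 - z.2)) (by fun_prop)
    _ ≤ _ := by
        gcongr
        exact lintegral_lintegral_invSqrt_le

theorem aemeasurable_sqrt_mul_sq_lintegral_displacementOsc
    (hWm : Measurable fun z : (ℝ × ℝ) × Ω => W z.1 z.2)
    (hmeas : Measurable fun q : (ℝ × ℝ) × EuclideanSpace ℝ (Fin d) => b q.1 q.2) (m : ℝ) :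
    AEMeasurable (fun z : Ω × ℝ => ENNReal.ofReal √z.2 *
      (∫⁻ s in Ioo (0 : ℝ) 1, displacementOsc b m ((s, z.2), W (s, z.2) z.1)) ^ 2)
      (P.prod (volume.restrict (Ioo (0 : ℝ) 1))) := by
  have h := (aemeasurable_displacementOsc_comp hmeas m
    (μ := (P.prod (volume.restrict (Ioo (0 : ℝ) 1))).prod (volume.restrict (Ioo (0 : ℝ) 1)))
    (f := fun z : (Ω × ℝ) × ℝ => ((z.2, z.1.2), W (z.2, z.1.2) z.1.1))
    (by fun_prop)).lintegral_prod_right'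
  exact AEMeasurable.mul (by fun_prop) (h.pow_const 2)

theorem aemeasurable_oscEnergy
    (hWm : Measurable fun z : (ℝ × ℝ) × Ω => W z.1 z.2)
    (hmeas : Measurable fun q : (ℝ × ℝ) × EuclideanSpace ℝ (Fin d) => b q.1 q.2) (m : ℝ) :
    AEMeasurable (fun ω => oscEnergy b (fun p => W p ω) m) P :=
  (aemeasurable_sqrt_mul_sq_lintegral_displacementOsc hWm hmeas m).lintegral_prod_right'

theorem lintegral_oscEnergy_le (hW : IsBrownianSheet P d W)
    (hWm : Measurable fun z : (ℝ × ℝ) × Ω => W z.1 z.2) (hd : 0 < d)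
    (hmeas : Measurable fun q : (ℝ × ℝ) × EuclideanSpace ℝ (Fin d) => b q.1 q.2)
    {K : ℝ} (hK : ∀ p x, |∑ i, (bhat p x i + bcheck p x i)| ≤ K)
    (hdecomp : ∀ p x, b p x = bhat p x - bcheck p x)
    (hmono : ∀ p (x y : EuclideanSpace ℝ (Fin d)), (∀ j, x j ≤ y j) →
      ∀ i, bhat p x i ≤ bhat p y i ∧ bcheck p x i ≤ bcheck p y i)
    {m : ℝ} (hm : 0 ≤ m) :
    ∫⁻ ω, oscEnergy b (fun p => W p ω) m ∂P ≤ ENNReal.ofReal (4 * K * m * √d) ^ 2 * 16 := by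
  unfold oscEnergy
  rw [lintegral_lintegral_swap
    (aemeasurable_sqrt_mul_sq_lintegral_displacementOsc hWm hmeas m)]
  have hi := measurable_invSqrt
  calc _ ≤ ∫⁻ t in Ioo (0 : ℝ) 1, ENNReal.ofReal (4 * K * m * √d) ^ 2 * 8 * invSqrt t := by
        refine setLIntegral_mono (by fun_prop) fun t ht => ?_
        rw [lintegral_const_mul' _ _ ENNReal.ofReal_ne_top]
        refine (mul_le_mul_right (hW.lintegral_sq_lintegral_displacementOsc_le hWm hd hmeas hK
          hdecomp hmono hm ht) _).trans (le_of_eq ?_)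
        have : ENNReal.ofReal √t * invSqrt t = 1 := by
          have h0 : 0 < √t := Real.sqrt_pos.2 ht.1
          rw [invSqrt, ← ENNReal.ofReal_mul h0.le, mul_inv_cancel₀ h0.ne', ENNReal.ofReal_one]
        calc _ = ENNReal.ofReal (4 * K * m * √d) ^ 2 * 8 * invSqrt t *
              (ENNReal.ofReal √t * invSqrt t) := by ring
          _ = _ := by rw [this, mul_one]
    _ = _ := by
        rw [lintegral_const_mul _ hi, lintegral_invSqrt_Ioo, mul_assoc]
        norm_num

end IsBrownianSheet

/-- Averages of functions with uniformly bounded integrals are almost surely bounded along a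
subsequence. -/
theorem ae_exists_frequently_sum_le {Ω : Type*} [MeasurableSpace Ω] {P : Measure Ω}
    [IsFiniteMeasure P] {A : ℕ → Ω → ENNReal} (hA : ∀ j, AEMeasurable (A j) P) {C : ENNReal}
    (hC : C ≠ ⊤) (hAC : ∀ j, ∫⁻ ω, A j ω ∂P ≤ C) :
    ∀ᵐ ω ∂P, ∃ M : ℝ, ∃ᶠ N : ℕ in atTop,
      ∑ j ∈ Finset.range N, A j ω ≤ ENNReal.ofReal (M * N) := by
  have hm : ∀ N : ℕ, AEMeasurable (fun ω => (∑ j ∈ Finset.range N, A j ω) / N) P := fun N =>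
    (Finset.aemeasurable_fun_sum _ fun j _ => hA j).div_const _
  have hle : ∀ N : ℕ, ∫⁻ ω, (∑ j ∈ Finset.range N, A j ω) / N ∂P ≤ C := fun N => by
    simp_rw [div_eq_mul_inv]
    rw [lintegral_mul_const'' _ (Finset.aemeasurable_fun_sum _ fun j _ => hA j),
      lintegral_finsetSum' _ fun j _ => hA j, ← div_eq_mul_inv]
    refine ENNReal.div_le_of_le_mul ?_
    refine (Finset.sum_le_sum fun j _ => hAC j).trans (le_of_eq ?_)
    rw [Finset.sum_const, Finset.card_range, nsmul_eq_mul, mul_comm]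
  have hfin : ∫⁻ ω, liminf (fun N : ℕ => (∑ j ∈ Finset.range N, A j ω) / N) atTop ∂P ≠ ⊤ := by
    refine ne_top_of_le_ne_top hC ((lintegral_liminf_le' hm).trans ?_)
    exact liminf_le_of_le (by isBoundedDefault) fun c hc =>
      let ⟨N, hN⟩ := hc.exists
      hN.trans (hle N)
  have hlm : AEMeasurable
      (fun ω => liminf (fun N : ℕ => (∑ j ∈ Finset.range N, A j ω) / N) atTop) P := by
    simp_rw [liminf_eq_iSup_iInf_of_nat]
    exact AEMeasurable.iSup fun n => AEMeasurable.biInf _ (to_countable _) fun N _ => hm N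
  filter_upwards [ae_lt_top' hlm hfin] with ω hω
  obtain ⟨M, hM, hM'⟩ := exists_between hω
  refine ⟨M.toReal, ?_⟩
  refine (frequently_lt_of_liminf_lt (by isBoundedDefault) hM).mono fun N hN => ?_
  rw [ENNReal.ofReal_mul ENNReal.toReal_nonneg, ENNReal.ofReal_toReal hM'.ne,
    ENNReal.ofReal_natCast]
  rcases N.eq_zero_or_pos with rfl | hN0
  · simp
  · exact (ENNReal.div_le_iff (by positivity) (ENNReal.natCast_ne_top N)).1 hN.le

theorem IsBrownianSheet.ae_exists_frequently_sum_oscEnergy_le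
    {Ω : Type*} [MeasurableSpace Ω] {P : Measure Ω} [IsProbabilityMeasure P] {d : ℕ}
    {W : ℝ × ℝ → Ω → EuclideanSpace ℝ (Fin d)}
    {b bhat bcheck : ℝ × ℝ → EuclideanSpace ℝ (Fin d) → EuclideanSpace ℝ (Fin d)}
    (hW : IsBrownianSheet P d W)
    (hWm : Measurable fun z : (ℝ × ℝ) × Ω => W z.1 z.2) (hd : 0 < d)
    (hmeas : Measurable fun q : (ℝ × ℝ) × EuclideanSpace ℝ (Fin d) => b q.1 q.2)
    {K : ℝ} (hK : ∀ p x, |∑ i, (bhat p x i + bcheck p x i)| ≤ K)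
    (hdecomp : ∀ p x, b p x = bhat p x - bcheck p x)
    (hmono : ∀ p (x y : EuclideanSpace ℝ (Fin d)), (∀ j, x j ≤ y j) →
      ∀ i, bhat p x i ≤ bhat p y i ∧ bcheck p x i ≤ bcheck p y i) :
    ∀ᵐ ω ∂P, ∃ M : ℝ, ∃ᶠ N : ℕ in atTop, ∑ j ∈ Finset.range N,
      4 ^ j * oscEnergy b (fun p => W p ω) ((1 / 2) ^ j) ≤ ENNReal.ofReal (M * N) := by
  refine ae_exists_frequently_sum_le (C := ENNReal.ofReal (4 * K * √d) ^ 2 * 16)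
    (fun j => (aemeasurable_oscEnergy hWm hmeas _).const_mul _) (by finiteness) fun j => ?_
  rw [lintegral_const_mul' _ _ (by finiteness)]
  refine (mul_le_mul_right (hW.lintegral_oscEnergy_le hWm hd hmeas hK hdecomp hmono
    (by positivity)) _).trans (le_of_eq ?_)
  have h4 : (4 : ENNReal) ^ j * ENNReal.ofReal ((1 / 2) ^ j) ^ 2 = 1 := by
    rw [← ENNReal.ofReal_pow (by positivity), ← pow_mul, mul_comm j, pow_mul,
      show (4 : ENNReal) = ENNReal.ofReal 4 by norm_num, ← ENNReal.ofReal_pow (by norm_num),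
      ← ENNReal.ofReal_mul (by positivity), ← mul_pow]
    norm_num
  rw [show 4 * K * (1 / 2) ^ j * √d = (1 / 2) ^ j * (4 * K * √d) by ring,
    ENNReal.ofReal_mul (by positivity), mul_pow]
  calc _ = 4 ^ j * ENNReal.ofReal ((1 / 2) ^ j) ^ 2 *
        (ENNReal.ofReal (4 * K * √d) ^ 2 * 16) := by ring
    _ = _ := by rw [h4, one_mul]

theorem two_mul_le_ofReal_add {c : ℝ} (hc : 0 < c) {t : ℝ} (ht : 0 < t) (a : ENNReal) :
    2 * a ≤ ENNReal.ofReal c * invSqrt t + ENNReal.ofReal c⁻¹ * (ENNReal.ofReal √t * a ^ 2) := by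
  have h0 : 0 < √t := Real.sqrt_pos.2 ht
  rcases eq_or_ne a ⊤ with rfl | ha
  · have h : ENNReal.ofReal c⁻¹ * (ENNReal.ofReal √t * ⊤ ^ 2) = ⊤ := by
      rw [ENNReal.top_pow two_ne_zero, ENNReal.mul_top (by simpa using ht),
        ENNReal.mul_top (by simpa using hc)]
    rw [h, add_top]
    exact le_top
  · lift a to NNReal using ha
    rw [invSqrt, ← ENNReal.ofReal_coe_nnreal, show (2 : ENNReal) = ENNReal.ofReal 2 by norm_num,
      ← ENNReal.ofReal_pow a.coe_nonneg, ← ENNReal.ofReal_mul (by positivity),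
      ← ENNReal.ofReal_mul (by positivity), ← ENNReal.ofReal_mul (by positivity),
      ← ENNReal.ofReal_mul (by positivity), ← ENNReal.ofReal_add (by positivity) (by positivity)]
    refine ENNReal.ofReal_le_ofReal ?_
    have hx : 0 < c⁻¹ * √t := by positivity
    have h1 : c * (√t)⁻¹ + c⁻¹ * (√t * (a : ℝ) ^ 2) - 2 * a =
        c⁻¹ * √t * (c * (√t)⁻¹ - a) ^ 2 := by
      field_simp
      ring
    nlinarith [mul_nonneg hx.le (sq_nonneg (c * (√t)⁻¹ - a))]

/-- If the growth of `U` below the level `2⁻ʲ` is controlled by `∫ aⱼ` and the weighted energies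
of the rescaled functions `2ʲ aⱼ` are bounded on average, then `U` cannot leave zero. -/
theorem eq_zero_of_frequently_sum_energy_le {U : ℝ → ℝ} (hU : ContinuousOn U (Icc 0 1))
    (hU0 : U 0 = 0) {a : ℕ → ℝ → ENNReal}
    (ha : ∀ (j : ℕ) (t t' : ℝ), 0 ≤ t → t ≤ t' → t' ≤ 1 →
      (∀ r ∈ Ioo t t', U r ≤ (1 / 2) ^ j) → ENNReal.ofReal (U t' - U t) ≤ ∫⁻ r in Ioc t t', a j r)
    {M : ℝ} (hM : ∃ᶠ N : ℕ in atTop, ∑ j ∈ Finset.range N,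
      4 ^ j * ∫⁻ t in Ioo (0 : ℝ) 1, ENNReal.ofReal √t * a j t ^ 2 ≤ ENNReal.ofReal (M * N))
    {τ : ℝ} (hτ : τ ∈ Icc (0 : ℝ) 1) : U τ ≤ 0 := by
  by_contra! hpos
  obtain ⟨j₀, hj₀⟩ := exists_pow_lt_of_lt_one hpos (show (1 / 2 : ℝ) < 1 by norm_num)
  set S : ℕ → Set ℝ := fun j => {t | t ∈ Icc (0 : ℝ) 1 ∧ (1 / 2) ^ j ≤ U t} with hS
  have hanti : ∀ j k, j ≤ k → ((1 : ℝ) / 2) ^ k ≤ (1 / 2) ^ j := fun j k h =>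
    pow_le_pow_of_le_one (by norm_num) (by norm_num) h
  have hne : ∀ j, j₀ ≤ j → (S j).Nonempty := fun j hj => ⟨τ, hτ, (hanti _ _ hj).trans hj₀.le⟩
  have hbdd : ∀ j, BddBelow (S j) := fun j => ⟨0, fun t ht => ht.1.1⟩
  have hclosed : ∀ j, IsClosed (S j) := fun j =>
    (hU.preimage_isClosed_of_isClosed isClosed_Icc (isClosed_Ici (a := ((1 : ℝ) / 2) ^ j)))
  set T : ℕ → ℝ := fun j => sInf (S j) with hT
  have hmem : ∀ j, j₀ ≤ j → T j ∈ S j := fun j hj => (hclosed j).csInf_mem (hne j hj) (hbdd j)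
  have hlt : ∀ j, j₀ ≤ j → ∀ r, 0 ≤ r → r < T j → U r < (1 / 2) ^ j := by
    intro j hj r hr hrT
    by_contra! h
    exact absurd (csInf_le (hbdd j) ⟨⟨hr, hrT.le.trans (hmem j hj).1.2⟩, h⟩) (not_le.2 hrT)
  have hle : ∀ j, j₀ ≤ j → U (T j) ≤ (1 / 2) ^ j := by
    intro j hj
    by_contra! h
    obtain ⟨r, hr, hr'⟩ := intermediate_value_Icc (hmem j hj).1.1
      (hU.mono (Icc_subset_Icc_right (hmem j hj).1.2))
      (show ((1 : ℝ) / 2) ^ j ∈ Icc (U 0) (U (T j)) from ⟨by rw [hU0]; positivity, h.le⟩)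
    have hrT : r ≠ T j := fun h' => by rw [h'] at hr'; exact h.ne' hr'
    exact absurd hr' (hlt j hj r hr.1 (lt_of_le_of_ne hr.2 hrT)).ne
  have hmono : ∀ j, j₀ ≤ j → T (j + 1) ≤ T j := fun j hj =>
    csInf_le (hbdd _) ⟨(hmem j hj).1, (hanti _ _ j.le_succ).trans (hmem j hj).2⟩
  set I : ℕ → ENNReal := fun j =>
    4 ^ j * ∫⁻ t in Ioo (0 : ℝ) 1, ENNReal.ofReal √t * a j t ^ 2 with hI
  have step : ∀ {c : ℝ}, 0 < c → ∀ j, j₀ ≤ j →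
      1 ≤ ENNReal.ofReal c * (∫⁻ r in Ioc (T (j + 1)) (T j), invSqrt r) +
        ENNReal.ofReal c⁻¹ * I j := by
    intro c hc j hj
    have hT0 : 0 ≤ T (j + 1) := (hmem _ (hj.trans j.le_succ)).1.1
    have hT1 : T j ≤ 1 := (hmem j hj).1.2
    have h1 : ENNReal.ofReal ((1 / 2) ^ (j + 1)) ≤ ∫⁻ r in Ioc (T (j + 1)) (T j), a j r := by
      refine le_trans (ENNReal.ofReal_le_ofReal ?_) (ha j _ _ hT0 (hmono j hj) hT1 fun r hr =>
        (hlt j hj r (hT0.trans hr.1.le) hr.2).le)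
      have h2 := (hmem j hj).2
      have h3 := hle _ (hj.trans j.le_succ)
      rw [pow_succ] at h3 ⊢
      linarith
    have h2 : (2 : ENNReal) ^ (j + 1) * ENNReal.ofReal ((1 / 2) ^ (j + 1)) = 1 := by
      rw [show (2 : ENNReal) = ENNReal.ofReal 2 by norm_num, ← ENNReal.ofReal_pow (by norm_num),
        ← ENNReal.ofReal_mul (by positivity), ← mul_pow]
      norm_num
    calc (1 : ENNReal) ≤ 2 ^ (j + 1) * ∫⁻ r in Ioc (T (j + 1)) (T j), a j r := by
          rw [← h2]; gcongr
      _ = ∫⁻ r in Ioc (T (j + 1)) (T j), 2 * (2 ^ j * a j r) := by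
          rw [← lintegral_const_mul' _ _ (by finiteness)]
          exact lintegral_congr fun r => by ring
      _ ≤ ∫⁻ r in Ioc (T (j + 1)) (T j), (ENNReal.ofReal c * invSqrt r +
            ENNReal.ofReal c⁻¹ * 4 ^ j * (ENNReal.ofReal √r * a j r ^ 2)) := by
          refine lintegral_mono_ae ?_
          filter_upwards [self_mem_ae_restrict measurableSet_Ioc] with r hr
          refine (two_mul_le_ofReal_add hc (hT0.trans_lt hr.1) _).trans (le_of_eq ?_)
          rw [mul_pow, ← pow_mul, mul_comm j, pow_mul]
          norm_num
          ring
      _ = ENNReal.ofReal c * (∫⁻ r in Ioc (T (j + 1)) (T j), invSqrt r) +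
            ENNReal.ofReal c⁻¹ * (4 ^ j * ∫⁻ r in Ioc (T (j + 1)) (T j),
              ENNReal.ofReal √r * a j r ^ 2) := by
          rw [lintegral_add_left (measurable_invSqrt.const_mul _),
            lintegral_const_mul _ measurable_invSqrt, lintegral_const_mul' _ _ (by finiteness),
            mul_assoc]
      _ ≤ _ := by
          rw [hI]
          simp only [← setLIntegral_congr (Ioo_ae_eq_Ioc (μ := volume) (a := (0 : ℝ)) (b := 1)).symm]
          gcongr
  have hsum : ∀ {c : ℝ}, 0 < c → ∀ n : ℕ,
      (n : ENNReal) ≤ ENNReal.ofReal c * (∫⁻ r in Ioc (T (j₀ + n)) (T j₀), invSqrt r) +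
        ENNReal.ofReal c⁻¹ * ∑ j ∈ Finset.range (j₀ + n), I j := by
    intro c hc n
    have hTn : ∀ n, T (j₀ + n) ≤ T j₀ := by
      intro n
      induction n with
      | zero => exact le_rfl
      | succ n ih => exact (hmono _ (Nat.le_add_right _ _)).trans ih
    induction n with
    | zero => simp
    | succ n ih =>
      have hu : Ioc (T (j₀ + (n + 1))) (T j₀) =
          Ioc (T (j₀ + n + 1)) (T (j₀ + n)) ∪ Ioc (T (j₀ + n)) (T j₀) :=
        (Ioc_union_Ioc_eq_Ioc (hmono _ (Nat.le_add_right _ _)) (hTn n)).symm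
      rw [hu, lintegral_union measurableSet_Ioc (Ioc_disjoint_Ioc_of_le le_rfl), ← add_assoc,
        Finset.sum_range_succ, mul_add, mul_add, Nat.cast_add, Nat.cast_one]
      refine (add_le_add ih (step hc (j₀ + n) (Nat.le_add_right _ _))).trans (le_of_eq ?_)
      ring
  set M' : ℝ := max M 1 with hM'
  have hM0 : 0 < M' := zero_lt_one.trans_le (le_max_right _ _)
  obtain ⟨N, hN, hNlarge⟩ :=
    (hM.and_eventually (eventually_gt_atTop (max j₀ ⌈8 * M' + 2 * j₀⌉₊))).exists
  obtain ⟨n, rfl⟩ := Nat.exists_eq_add_of_le ((le_max_left _ _).trans hNlarge.le)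
  have h := hsum (c := 2 * M') (by positivity) n
  have hint : ∫⁻ r in Ioc (T (j₀ + n)) (T j₀), invSqrt r ≤ ENNReal.ofReal 2 := by
    rw [show ENNReal.ofReal 2 = 2 by norm_num, ← lintegral_invSqrt_Ioo,
      setLIntegral_congr (Ioo_ae_eq_Ioc (μ := volume) (a := (0 : ℝ)) (b := 1))]
    exact lintegral_mono_set (Ioc_subset_Ioc (hmem _ (Nat.le_add_right _ _)).1.1 (hmem _ le_rfl).1.2)
  have hN' : ∑ j ∈ Finset.range (j₀ + n), I j ≤ ENNReal.ofReal (M' * (j₀ + n : ℕ)) :=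
    hN.trans (ENNReal.ofReal_le_ofReal (by gcongr; exact le_max_left _ _))
  have h' : ENNReal.ofReal n ≤
      ENNReal.ofReal (2 * M' * 2 + (2 * M')⁻¹ * (M' * (j₀ + n : ℕ))) := by
    rw [ENNReal.ofReal_natCast, ENNReal.ofReal_add (by positivity) (by positivity),
      ENNReal.ofReal_mul (by positivity), ENNReal.ofReal_mul (p := (2 * M')⁻¹) (by positivity)]
    exact h.trans (by gcongr)
  rw [ENNReal.ofReal_le_ofReal_iff (by positivity)] at h'
  have h3 : (2 * M')⁻¹ * (M' * (j₀ + n : ℕ)) = (j₀ + n : ℕ) / 2 := by field_simp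
  have h4 : 8 * M' + 2 * j₀ < (j₀ + n : ℕ) :=
    (Nat.le_ceil _).trans_lt (by exact_mod_cast (le_max_right _ _).trans_lt hNlarge)
  rw [h3] at h'
  push_cast at h' h4
  linarith

theorem intervalIntegrable_intervalIntegral {E : Type*} [NormedAddCommGroup E] [NormedSpace ℝ E]
    [MeasurableSpace E] [BorelSpace E] [SecondCountableTopology E]
    {f : ℝ × ℝ → E} (hf : Measurable f) {B : ℝ} (hB : ∀ p, ‖f p‖ ≤ B) (s a c : ℝ) :
    IntervalIntegrable (fun t => ∫ r in (0 : ℝ)..s, f (r, t)) volume a c := by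
  have hm : StronglyMeasurable fun t => ∫ r in (0 : ℝ)..s, f (r, t) :=
    (StronglyMeasurable.integral_prod_right' (f := fun z : ℝ × ℝ => f (z.2, z.1))
      (by fun_prop)).sub (StronglyMeasurable.integral_prod_right'
        (f := fun z : ℝ × ℝ => f (z.2, z.1)) (by fun_prop))
  refine (intervalIntegrable_const (c := B * |s - 0|)).mono_fun hm.aestronglyMeasurable ?_
  refine ae_of_all _ fun t => ?_
  exact (intervalIntegral.norm_integral_le_of_norm_le_const fun r _ => hB (r, t)).trans
    (le_abs_self _)

/-- A path along which the energies of `b` are bounded on average forces uniqueness. -/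
theorem eq_zero_of_frequently_sum_oscEnergy_le {d : ℕ}
    {b : ℝ × ℝ → EuclideanSpace ℝ (Fin d) → EuclideanSpace ℝ (Fin d)}
    (hmeas : Measurable fun q : (ℝ × ℝ) × EuclideanSpace ℝ (Fin d) => b q.1 q.2)
    {B : ℝ} (hB : ∀ p x, ‖b p x‖ ≤ B) {w u : ℝ × ℝ → EuclideanSpace ℝ (Fin d)}
    (hw : Continuous w) (hu : Continuous u)
    (hsol : ∀ p ∈ Icc (0 : ℝ × ℝ) 1, u p = ∫ t₁ in (0 : ℝ)..p.2, ∫ s₁ in (0 : ℝ)..p.1,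
      (b (s₁, t₁) (w (s₁, t₁) + u (s₁, t₁)) - b (s₁, t₁) (w (s₁, t₁))))
    {M : ℝ} (hM : ∃ᶠ N : ℕ in atTop, ∑ j ∈ Finset.range N,
      4 ^ j * oscEnergy b w ((1 / 2) ^ j) ≤ ENNReal.ofReal (M * N))
    {p : ℝ × ℝ} (hp : p ∈ Icc (0 : ℝ × ℝ) 1) : u p = 0 := by
  set f : ℝ × ℝ → EuclideanSpace ℝ (Fin d) := fun q => b q (w q + u q) - b q (w q) with hf
  have hfm : Measurable f :=
    (hmeas.comp (f := fun q => (q, w q + u q)) (by fun_prop)).sub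
      (hmeas.comp (f := fun q => (q, w q)) (by fun_prop))
  have hfB : ∀ q, ‖f q‖ ≤ B + B := fun q => (norm_sub_le _ _).trans (add_le_add (hB _ _) (hB _ _))
  set U : ℝ → ℝ := fun t => sSup ((fun s => ‖u (s, t)‖) '' Icc 0 1) with hUdef
  have hUc : Continuous U := isCompact_Icc.continuous_sSup (by fun_prop)
  have hle : ∀ s ∈ Icc (0 : ℝ) 1, ∀ t, ‖u (s, t)‖ ≤ U t := fun s hs t =>
    le_csSup (isCompact_Icc.image (by fun_prop)).bddAbove (mem_image_of_mem _ hs)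
  have hatt : ∀ t, ∃ s ∈ Icc (0 : ℝ) 1, U t = ‖u (s, t)‖ := fun t =>
    isCompact_Icc.exists_sSup_image_eq ⟨0, left_mem_Icc.2 zero_le_one⟩ (by fun_prop)
  have hU0 : U 0 = 0 := by
    obtain ⟨s, hs, h⟩ := hatt 0
    rw [h, hsol (s, 0) ⟨⟨hs.1, le_rfl⟩, ⟨hs.2, zero_le_one⟩⟩]
    simp
  suffices h : U p.2 ≤ 0 from
    norm_le_zero_iff.1 ((hle p.1 ⟨hp.1.1, hp.2.1⟩ p.2).trans h)
  refine eq_zero_of_frequently_sum_energy_le hUc.continuousOn hU0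
    (a := fun j t => ∫⁻ s in Ioo (0 : ℝ) 1, displacementOsc b ((1 / 2) ^ j) ((s, t), w (s, t)))
    ?_ hM ⟨hp.1.2, hp.2.2⟩
  intro j t t' ht htt ht' hr
  obtain ⟨s, hs, hUt⟩ := hatt t'
  have hint := intervalIntegrable_intervalIntegral hfm hfB s
  have hdiff : u (s, t') - u (s, t) = ∫ r in t..t', ∫ s₁ in (0 : ℝ)..s, f (s₁, r) := by
    rw [hsol (s, t') ⟨⟨hs.1, ht.trans htt⟩, ⟨hs.2, ht'⟩⟩,
      hsol (s, t) ⟨⟨hs.1, ht⟩, ⟨hs.2, htt.trans ht'⟩⟩]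
    exact intervalIntegral.integral_interval_sub_left (hint 0 t') (hint 0 t)
  calc ENNReal.ofReal (U t' - U t) ≤ ENNReal.ofReal ‖u (s, t') - u (s, t)‖ := by
        refine ENNReal.ofReal_le_ofReal ?_
        rw [hUt]
        linarith [norm_sub_norm_le (u (s, t')) (u (s, t)), hle s hs t]
    _ = ‖∫ r in Ioc t t', ∫ s₁ in (0 : ℝ)..s, f (s₁, r)‖ₑ := by
        rw [ofReal_norm, hdiff, intervalIntegral.integral_of_le htt]
    _ ≤ ∫⁻ r in Ioc t t', ‖∫ s₁ in (0 : ℝ)..s, f (s₁, r)‖ₑ := enorm_integral_le_lintegral_enorm _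
    _ ≤ _ := by
        rw [← setLIntegral_congr (Ioo_ae_eq_Ioc (μ := volume) (a := t) (b := t')),
          ← setLIntegral_congr (Ioo_ae_eq_Ioc (μ := volume) (a := t) (b := t'))]
        refine lintegral_mono_ae ?_
        filter_upwards [self_mem_ae_restrict measurableSet_Ioo] with r hr'
        rw [intervalIntegral.integral_of_le hs.1, integral_Ioc_eq_integral_Ioo]
        refine (enorm_integral_le_lintegral_enorm _).trans
          ((lintegral_mono_set (Ioo_subset_Ioo_right hs.2)).trans (lintegral_mono_ae ?_))
        filter_upwards [self_mem_ae_restrict measurableSet_Ioo] with s₁ hs₁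
        exact le_iSup₂_of_le (u (s₁, r))
          ((hle s₁ ⟨le_of_lt hs₁.1, le_of_lt hs₁.2⟩ r).trans (hr r hr')) le_rfl

/-- The projection of the plane onto the unit square. -/
def projUnitSquare (p : ℝ × ℝ) : ℝ × ℝ := (min (max p.1 0) 1, min (max p.2 0) 1)

theorem continuous_projUnitSquare : Continuous projUnitSquare := by
  unfold projUnitSquare
  fun_prop

theorem projUnitSquare_mem (p : ℝ × ℝ) : projUnitSquare p ∈ Icc (0 : ℝ × ℝ) 1 :=
  ⟨⟨le_min (le_max_right _ _) zero_le_one, le_min (le_max_right _ _) zero_le_one⟩,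
    ⟨min_le_right _ _, min_le_right _ _⟩⟩

theorem projUnitSquare_of_mem {p : ℝ × ℝ} (hp : p ∈ Icc (0 : ℝ × ℝ) 1) :
    projUnitSquare p = p :=
  Prod.ext ((min_eq_left (max_le hp.2.1 zero_le_one)).trans (max_eq_left hp.1.1))
    ((min_eq_left (max_le hp.2.2 zero_le_one)).trans (max_eq_left hp.1.2))

theorem ContinuousOn.comp_projUnitSquare {E : Type*} [TopologicalSpace E] {f : ℝ × ℝ → E}
    (hf : ContinuousOn f (Icc (0 : ℝ × ℝ) 1)) : Continuous fun p => f (projUnitSquare p) :=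
  hf.comp_continuous continuous_projUnitSquare projUnitSquare_mem

theorem IsBrownianSheet.comp_projUnitSquare {Ω : Type*} [MeasurableSpace Ω] {P : Measure Ω}
    {d : ℕ} {W : ℝ × ℝ → Ω → EuclideanSpace ℝ (Fin d)} (hW : IsBrownianSheet P d W) :
    IsBrownianSheet P d fun p => W (projUnitSquare p) := by
  refine ⟨fun p => hW.1 _, fun ω => (hW.2.1 ω).comp_projUnitSquare.continuousOn,
    fun ω p hp h => ?_, fun n p idx c hp => ?_⟩
  · simp only [projUnitSquare_of_mem hp]
    exact hW.2.2.1 ω p hp h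
  · simp_rw [projUnitSquare_of_mem (hp _)]
    exact hW.2.2.2 n p idx c hp

/-- on a full-measure set of sheet paths, `u ≡ 0` is the unique continuous
solution of the difference integral equation. -/
theorem statement3 {Ω : Type*} [MeasurableSpace Ω] (P : Measure Ω) [IsProbabilityMeasure P]
    (d : ℕ) (W : ℝ × ℝ → Ω → EuclideanSpace ℝ (Fin d)) (hW : IsBrownianSheet P d W)
    (b bhat bcheck : ℝ × ℝ → EuclideanSpace ℝ (Fin d) → EuclideanSpace ℝ (Fin d))
    (hmeas : Measurable fun q : (ℝ × ℝ) × EuclideanSpace ℝ (Fin d) => b q.1 q.2)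
    (hbdd : ∀ i, ∃ K : ℝ, ∀ p x, |bhat p x i| ≤ K ∧ |bcheck p x i| ≤ K)
    (hdecomp : ∀ p x, b p x = bhat p x - bcheck p x)
    (hmono : ∀ p (x y : EuclideanSpace ℝ (Fin d)), (∀ j, x j ≤ y j) →
      ∀ i, bhat p x i ≤ bhat p y i ∧ bcheck p x i ≤ bcheck p y i) :
    ∃ Ω₁ : Set Ω, MeasurableSet Ω₁ ∧ P Ω₁ = 1 ∧
      ∀ ω ∈ Ω₁, ∀ u : ℝ × ℝ → EuclideanSpace ℝ (Fin d),
        ContinuousOn u (Set.Icc (0 : ℝ × ℝ) 1) →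
        (∀ p ∈ Set.Icc (0 : ℝ × ℝ) 1,
          u p = ∫ t₁ in (0:ℝ)..p.2, ∫ s₁ in (0:ℝ)..p.1,
            (b (s₁, t₁) (W (s₁, t₁) ω + u (s₁, t₁)) - b (s₁, t₁) (W (s₁, t₁) ω))) →
        ∀ p ∈ Set.Icc (0 : ℝ × ℝ) 1, u p = 0 := by
  rcases d.eq_zero_or_pos with rfl | hd
  · exact ⟨univ, MeasurableSet.univ, measure_univ, fun _ _ _ _ _ _ _ => Subsingleton.elim _ _⟩
  choose K hK using hbdd
  have hKsum : ∀ p x, |∑ i, (bhat p x i + bcheck p x i)| ≤ ∑ i, (K i + K i) := fun p x =>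
    (Finset.abs_sum_le_sum_abs _ _).trans (Finset.sum_le_sum fun i _ =>
      (abs_add_le _ _).trans (add_le_add (hK i p x).1 (hK i p x).2))
  have hB : ∀ p x, ‖b p x‖ ≤ ∑ i, (K i + K i) := fun p x => by
    refine (EuclideanSpace.norm_le_sum_abs _).trans (Finset.sum_le_sum fun i _ => ?_)
    rw [hdecomp, PiLp.sub_apply]
    exact (abs_sub _ _).trans (add_le_add (hK i p x).1 (hK i p x).2)
  have hWc : ∀ ω, Continuous fun p => W (projUnitSquare p) ω := fun ω =>
    (hW.2.1 ω).comp_projUnitSquare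
  have hWm : Measurable fun z : (ℝ × ℝ) × Ω => W (projUnitSquare z.1) z.2 :=
    measurable_uncurry_of_continuous_of_measurable (u := fun p ω => W (projUnitSquare p) ω)
      hWc fun p => hW.1 _
  obtain ⟨Ω₁, hΩ₁, hm, h⟩ := (hW.comp_projUnitSquare.ae_exists_frequently_sum_oscEnergy_le hWm hd
    hmeas hKsum hdecomp hmono).exists_measurable_mem
  refine ⟨Ω₁, hm, (mem_ae_iff_prob_eq_one hm).1 hΩ₁, fun ω hω u hu hsol p hp => ?_⟩
  obtain ⟨M, hM⟩ := h ω hω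
  rw [← projUnitSquare_of_mem hp]
  refine eq_zero_of_frequently_sum_oscEnergy_le hmeas hB (hWc ω) hu.comp_projUnitSquare
    (fun q hq => ?_) hM hp
  rw [projUnitSquare_of_mem hq, hsol q hq]
  refine intervalIntegral.integral_congr fun t ht => intervalIntegral.integral_congr fun s hs => ?_
  rw [uIcc_of_le (show (0 : ℝ) ≤ q.2 from hq.1.2)] at ht
  rw [uIcc_of_le (show (0 : ℝ) ≤ q.1 from hq.1.1)] at hs
  simp only [projUnitSquare_of_mem (show (s, t) ∈ Icc (0 : ℝ × ℝ) 1 from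
    ⟨⟨hs.1, ht.1⟩, ⟨hs.2.trans hq.2.1, ht.2.trans hq.2.2⟩⟩)]
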